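/- arXiv:2504.16205 — 2 statements merged into one kernel-verified Lean document; each statement's English description precedes it below -/
import Mathlib

section
/- Let m ≥ 3 and let S ⊆ ZMod m with |S| = 3 and 0 ∈ S. If the cyclic Haar graph H(m;S) = B(m;∅,S,∅) is connected, then it is Hamiltonian. -/
open SimpleGraph

/-- The bicirculant graph `B(m;R,S,T)` on vertex set `ZMod m ⊕ ZMod m`. -/
def bicirculant (m : ℕ) (R S T : Set (ZMod m)) : SimpleGraph (ZMod m ⊕ ZMod m) :=
  SimpleGraph.fromRel (fun x y =>
    match x, y with
    | Sum.inl i, Sum.inl i' => ∃ j ∈ R, i' = i + j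
    | Sum.inr i, Sum.inr i' => ∃ j ∈ T, i' = i + j
    | Sum.inl i, Sum.inr i' => ∃ j ∈ S, i' = i + j
    | Sum.inr _, Sum.inl _ => False)

/-- The cyclic Haar graph `H(m;S) = B(m;∅,S,∅)`. -/
def haarGraph (m : ℕ) (S : Set (ZMod m)) : SimpleGraph (ZMod m ⊕ ZMod m) :=
  bicirculant m ∅ S ∅

/-- A bijection `f : Fin n ≃ V` listing the vertices along a Hamiltonian path of `G`. -/
def IsHamiltonianEnum {V : Type*} (G : SimpleGraph V) {n : ℕ} (f : Fin n ≃ V) : Prop :=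
  ∀ i j : Fin n, i.val + 1 = j.val → G.Adj (f i) (f j)

/-- The involution of `Fin n` fixing every index up to `i` and reversing the remaining ones. -/
def revAfter {n : ℕ} (i : Fin n) : Equiv.Perm (Fin n) :=
  Function.Involutive.toPerm
    (fun j => if h : j.val ≤ i.val then j else ⟨n + i.val - j.val, by omega⟩) (by
      intro j
      have := j.2
      by_cases h : j.val ≤ i.val
      · simp only [h, dite_true]
      · have h' : ¬n + i.val - j.val ≤ i.val := by omega
        ext
        simp only [h, h', dite_false]
        omega)

theorem revAfter_of_le {n : ℕ} {i j : Fin n} (h : j.val ≤ i.val) : revAfter i j = j :=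
  dif_pos h

theorem val_revAfter_of_lt {n : ℕ} {i j : Fin n} (h : i.val < j.val) :
    (revAfter i j).val = n + i.val - j.val :=
  congrArg Fin.val (dif_neg (Nat.not_le.mpr h))

theorem revAfter_trans_revAfter {V : Type*} {n : ℕ} (i : Fin n) (f : Fin n ≃ V) :
    (revAfter i).trans ((revAfter i).trans f) = f := by
  ext j
  change f (revAfter i (revAfter i j)) = f j
  congr 1
  exact Function.Involutive.toPerm_involutive _ j

theorem IsHamiltonianEnum.revAfter {V : Type*} {G : SimpleGraph V} {n : ℕ} {f : Fin n ≃ V}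
    (hf : IsHamiltonianEnum G f) {i l : Fin n} (hl : l.val + 1 = n) (h : G.Adj (f i) (f l)) :
    IsHamiltonianEnum G ((revAfter i).trans f) := by
  intro j k hjk
  change G.Adj (f (_root_.revAfter i j)) (f (_root_.revAfter i k))
  rcases lt_trichotomy j.val i.val with hj | hj | hj
  · rw [revAfter_of_le hj.le, revAfter_of_le (by omega)]
    exact hf j k hjk
  · obtain rfl : j = i := Fin.ext hj
    have hk : _root_.revAfter j k = l := by
      ext
      rw [val_revAfter_of_lt (by omega)]
      omega
    rwa [revAfter_of_le le_rfl, hk]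
  · refine (hf _ _ ?_).symm
    rw [val_revAfter_of_lt hj, val_revAfter_of_lt (by omega)]
    omega

open Classical in
/-- In a cubic graph, the number of Hamiltonian cycles with a prescribed first edge is even. -/
theorem even_card_hamiltonianEnum_closed {V : Type*} [Fintype V] (G : SimpleGraph V)
    (hG : G.IsRegularOfDegree 3) (n : ℕ) (x y : V) :
    Even (Finset.card {f : Fin (n + 3) ≃ V | (IsHamiltonianEnum G f ∧ f 0 = x ∧ f 1 = y) ∧
      G.Adj (f (Fin.last _)) (f 0)}) := by
  set P : Finset (Fin (n + 3) ≃ V) := {f | IsHamiltonianEnum G f ∧ f 0 = x ∧ f 1 = y} with hP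
  let pos (i : Fin n) : Fin (n + 3) := i.succ.castSucc.castSucc
  have hpairs : ∑ q : (Fin (n + 3) ≃ V) × Fin n with
      q.1 ∈ P ∧ G.Adj (q.1 (Fin.last _)) (q.1 (pos q.2)), (1 : ZMod 2) = 0 := by
    have hlast (i : Fin n) : (pos i).val < (Fin.last (n + 2)).val := by
      simp only [pos, Fin.val_last, Fin.val_castSucc, Fin.val_succ]
      omega
    have hpos (i : Fin n) : (pos i).val = i.val + 1 := by simp [pos]
    refine Finset.sum_involution (fun q _ => ((revAfter (pos q.2)).trans q.1, q.2))
      (fun _ _ => by decide) ?_ ?_ ?_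
    · rintro ⟨f, i⟩ - - h
      have h1 := congrArg (fun e : Fin (n + 3) ≃ V => f.symm (e (Fin.last _)))
        (congrArg Prod.fst h)
      simp only [Equiv.trans_apply, Equiv.symm_apply_apply] at h1
      have h2 := val_revAfter_of_lt (hlast i)
      rw [h1, hpos, Fin.val_last] at h2
      omega
    · rintro ⟨f, i⟩ hq
      simp only [hP, Finset.mem_filter, Finset.mem_univ, true_and, Equiv.trans_apply] at hq ⊢
      obtain ⟨⟨hf, h0, h1⟩, hadj⟩ := hq
      refine ⟨⟨hf.revAfter (by simp) hadj.symm, ?_, ?_⟩, ?_⟩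
      · rwa [revAfter_of_le (by simp)]
      · rwa [revAfter_of_le (by simp [hpos])]
      · rw [revAfter_of_le le_rfl]
        refine (hf _ _ ?_).symm
        rw [val_revAfter_of_lt (hlast i), Fin.val_last]
        omega
    · rintro ⟨f, i⟩ -
      exact Prod.ext (revAfter_trans_revAfter _ f) rfl
  have hcount (f : Fin (n + 3) ≃ V) (hf : f ∈ P) :
      ∑ i : Fin n, (if G.Adj (f (Fin.last _)) (f (pos i)) then (1 : ZMod 2) else 0) =
        if G.Adj (f (Fin.last _)) (f 0) then 1 else 0 := by
    have h3 : ∑ i, (if G.Adj (f (Fin.last _)) (f i) then (1 : ZMod 2) else 0) = 3 := by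
      rw [f.sum_comp (fun v => if G.Adj (f (Fin.last _)) v then (1 : ZMod 2) else 0),
        Finset.sum_boole, ← G.neighborFinset_eq_filter, G.card_neighborFinset_eq_degree,
        hG.degree_eq]
      rfl
    simp only [hP, Finset.mem_filter, Finset.mem_univ, true_and] at hf
    have hprev : G.Adj (f (Fin.last _)) (f (Fin.last (n + 1)).castSucc) :=
      (hf.1 _ _ (by simp)).symm
    rw [Fin.sum_univ_castSucc, if_neg (G.loopless.irrefl _), Fin.sum_univ_castSucc, if_pos hprev,
      Fin.sum_univ_succ] at h3
    simp only [Fin.castSucc_zero] at h3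
    change (_ + ∑ i : Fin n, (if G.Adj (f (Fin.last _)) (f (pos i)) then (1 : ZMod 2) else 0))
      + 1 + 0 = 3 at h3
    generalize ∑ i : Fin n, (if G.Adj (f (Fin.last _)) (f (pos i)) then (1 : ZMod 2) else 0) = s
      at h3 ⊢
    by_cases h : G.Adj (f (Fin.last _)) (f 0) <;> simp only [h, if_true, if_false] at h3 ⊢ <;>
      revert s <;> decide
  rw [← ZMod.natCast_eq_zero_iff_even, ← Finset.filter_filter, ← Finset.sum_boole, ← hP,
    ← Finset.sum_congr rfl hcount, ← Finset.sum_product']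
  refine Eq.trans ?_ hpairs
  rw [← Finset.sum_filter]
  refine Finset.sum_congr ?_ fun _ _ => rfl
  ext q
  simp

/-- A Hamiltonian cycle of a cubic graph is not the only one. -/
theorem exists_second_hamiltonianEnum {V : Type*} [Fintype V] (G : SimpleGraph V)
    [DecidableRel G.Adj] (hG : G.IsRegularOfDegree 3) {n : ℕ}
    (f : Fin (n + 3) ≃ V) (hf : IsHamiltonianEnum G f) (hclosed : G.Adj (f (Fin.last _)) (f 0)) :
    ∃ g : Fin (n + 3) ≃ V, g ≠ f ∧ IsHamiltonianEnum G g ∧ g 0 = f 0 ∧ g 1 = f 1 ∧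
      G.Adj (g (Fin.last _)) (g 0) := by
  classical
  have heven := even_card_hamiltonianEnum_closed G (by convert hG) n (f 0) (f 1)
  have hmem : f ∈ ({g : Fin (n + 3) ≃ V | (IsHamiltonianEnum G g ∧ g 0 = f 0 ∧ g 1 = f 1) ∧
      G.Adj (g (Fin.last _)) (g 0)} : Finset _) := by simp [hf, hclosed]
  have hlt : 1 < Finset.card {g : Fin (n + 3) ≃ V |
      (IsHamiltonianEnum G g ∧ g 0 = f 0 ∧ g 1 = f 1) ∧ G.Adj (g (Fin.last _)) (g 0)} := by
    have hpos := Finset.card_pos.mpr ⟨f, hmem⟩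
    obtain ⟨c, hc⟩ := heven
    grind
  obtain ⟨g, hg, hne⟩ := Finset.exists_mem_ne hlt f
  simp only [Finset.mem_filter, Finset.mem_univ, true_and] at hg
  exact ⟨g, hne, hg.1.1, hg.1.2.1, hg.1.2.2, hg.2⟩

/-- The cycle through all vertices in the cyclic order given by `f`. -/
abbrev enumCycle {V : Type*} {n : ℕ} (f : Fin (n + 3) ≃ V) : SimpleGraph V :=
  (cycleGraph (n + 3)).comap f.symm

theorem enumCycle_le {V : Type*} {G : SimpleGraph V} {n : ℕ} {f : Fin (n + 3) ≃ V}
    (hf : IsHamiltonianEnum G f) (hclosed : G.Adj (f (Fin.last _)) (f 0)) :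
    enumCycle f ≤ G := by
  have hstep (i : Fin (n + 3)) : G.Adj (f i) (f (i + 1)) := by
    rcases Fin.eq_castSucc_or_eq_last i with ⟨j, rfl⟩ | rfl
    · exact hf _ _ (by simp)
    · simpa using hclosed
  intro p q h
  rw [comap_adj, cycleGraph_adj] at h
  rcases h with h | h
  · have := hstep (f.symm q)
    rw [← h, add_sub_cancel] at this
    simpa using this.symm
  · have := hstep (f.symm p)
    rw [← h, add_sub_cancel] at this
    simpa using this

theorem enumCycle_connected {V : Type*} {n : ℕ} (f : Fin (n + 3) ≃ V) :
    (enumCycle f).Connected :=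
  (Iso.comap f.symm (cycleGraph (n + 3))).connected_iff.mpr cycleGraph_connected

theorem ncard_neighborSet_enumCycle {V : Type*} {n : ℕ} (f : Fin (n + 3) ≃ V) (v : V) :
    ((enumCycle f).neighborSet v).ncard = 2 := by
  rw [← Nat.card_coe_set_eq,
    Nat.card_congr ((Iso.comap f.symm (cycleGraph (n + 3))).mapNeighborSet v),
    Nat.card_eq_fintype_card, card_neighborSet_eq_degree, cycleGraph_degree_three_le]

theorem eq_of_enumCycle_le {V : Type*} {n : ℕ} {f g : Fin (n + 3) ≃ V}
    (h0 : g 0 = f 0) (h1 : g 1 = f 1) (h : enumCycle g ≤ enumCycle f) : g = f := by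
  have key : ∀ j : ℕ, ∀ hj : j + 1 < n + 3,
      g ⟨j, by omega⟩ = f ⟨j, by omega⟩ ∧ g ⟨j + 1, hj⟩ = f ⟨j + 1, hj⟩ := by
    intro j
    induction j with
    | zero => exact fun _ => ⟨h0, h1⟩
    | succ j ih =>
      intro hj
      obtain ⟨ih0, ih1⟩ := ih (by omega)
      refine ⟨ih1, ?_⟩
      have hadj : (enumCycle g).Adj (g ⟨j + 1, by omega⟩) (g ⟨j + 2, hj⟩) := by
        rw [comap_adj, cycleGraph_adj]
        right
        simp only [Equiv.symm_apply_apply]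
        rw [sub_eq_iff_eq_add']
        ext
        simp [Fin.val_add, Nat.mod_eq_of_lt hj]
      have := h hadj
      rw [ih1, comap_adj, cycleGraph_adj, Equiv.symm_apply_apply] at this
      rcases this with h2 | h2
      · exfalso
        have h3 : f.symm (g ⟨j + 2, hj⟩) = ⟨j, by omega⟩ := by
          rw [sub_eq_iff_eq_add, ← sub_eq_iff_eq_add'] at h2
          rw [← h2, sub_eq_iff_eq_add']
          ext
          simp [Fin.val_add, add_comm, Nat.mod_eq_of_lt (show j + 1 < n + 3 by omega)]
        rw [Equiv.symm_apply_eq, ← ih0, EmbeddingLike.apply_eq_iff_eq, Fin.mk.injEq] at h3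
        omega
      · rw [← Equiv.symm_apply_eq, sub_eq_iff_eq_add.mp h2]
        ext
        simp [Fin.val_add, add_comm]
        omega
  ext i
  obtain ⟨i, hi⟩ := i
  rcases i with _ | i
  · exact h0
  · exact (key i hi).2

/-- A cubic graph with a Hamiltonian cycle has a second one, given here as a subgraph. -/
theorem exists_second_hamiltonian_cycle {V : Type*} [Fintype V] (G : SimpleGraph V)
    [DecidableRel G.Adj] (hG : G.IsRegularOfDegree 3) {n : ℕ}
    (f : Fin (n + 3) ≃ V) (hf : IsHamiltonianEnum G f) (hclosed : G.Adj (f (Fin.last _)) (f 0)) :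
    ∃ F ≤ G, F.Connected ∧ (∀ v, (F.neighborSet v).ncard = 2) ∧
      ∃ p q, F.Adj p q ∧ ¬ (enumCycle f).Adj p q := by
  obtain ⟨g, hne, hg, h0, h1, hgc⟩ := exists_second_hamiltonianEnum G hG f hf hclosed
  refine ⟨enumCycle g, enumCycle_le hg hgc, enumCycle_connected g,
    ncard_neighborSet_enumCycle g, ?_⟩
  by_contra! h
  exact hne (eq_of_enumCycle_le h0 h1 fun p q => h p q)

/-- A finite connected graph all of whose vertices have degree two is Hamiltonian. -/
theorem isHamiltonian_of_connected_of_ncard_neighborSet {V : Type*} [Fintype V] [DecidableEq V]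
    {F : SimpleGraph V} (hF : F.Connected) (h2 : ∀ v, (F.neighborSet v).ncard = 2) :
    F.IsHamiltonian := by
  intro _
  obtain ⟨v⟩ := hF.nonempty
  have hcyc : F.IsCycles := fun w _ => h2 w
  obtain ⟨p, hp, hverts⟩ := hcyc.exists_cycle_toSubgraph_verts_eq_connectedComponentSupp
    (c := F.connectedComponentMk v) rfl
    (Set.nonempty_of_ncard_ne_zero (by rw [h2]; decide))
  refine ⟨v, p, Walk.isHamiltonianCycle_isCycle_and_isHamiltonian_tail.mpr ⟨hp, ?_⟩⟩
  refine hp.isPath_tail.isHamiltonian_of_mem fun w => ?_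
  have hw : w ∈ p.support := by
    rw [← Walk.mem_verts_toSubgraph, hverts, ConnectedComponent.mem_supp_iff,
      ConnectedComponent.eq]
    exact hF.preconnected w v
  rw [Walk.support_tail_of_not_nil _ hp.not_nil]
  by_cases hwv : w = v
  · exact hwv ▸ Walk.end_mem_tail_support hp.not_nil
  · rw [← Walk.cons_tail_support] at hw
    exact (List.mem_cons.mp hw).resolve_left hwv

theorem haarGraph_adj_inl_inr {m : ℕ} {S : Set (ZMod m)} {x y : ZMod m} :
    (haarGraph m S).Adj (Sum.inl x) (Sum.inr y) ↔ ∃ s ∈ S, y = x + s := by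
  simp [haarGraph, bicirculant]

theorem haarGraph_not_adj_inl_inl {m : ℕ} {S : Set (ZMod m)} {x y : ZMod m} :
    ¬(haarGraph m S).Adj (Sum.inl x) (Sum.inl y) := by
  simp [haarGraph, bicirculant]

theorem haarGraph_not_adj_inr_inr {m : ℕ} {S : Set (ZMod m)} {x y : ZMod m} :
    ¬(haarGraph m S).Adj (Sum.inr x) (Sum.inr y) := by
  simp [haarGraph, bicirculant]

theorem ncard_neighborSet_inl_of_le {m : ℕ} {c : Fin 3 → ZMod m} (hc : Function.Injective c)
    {F : SimpleGraph (ZMod m ⊕ ZMod m)} (hF : F ≤ haarGraph m (Set.range c)) (x : ZMod m) :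
    (F.neighborSet (Sum.inl x)).ncard = {s | F.Adj (Sum.inl x) (Sum.inr (x + c s))}.ncard := by
  rw [← Set.ncard_image_of_injective (f := fun s => (Sum.inr (x + c s) : ZMod m ⊕ ZMod m))
    _ fun s t h => hc (add_left_cancel (Sum.inr_injective h))]
  congr 1
  ext (y | y)
  · simpa using fun h => haarGraph_not_adj_inl_inl (hF h)
  · simp only [mem_neighborSet, Set.mem_image, Set.mem_ofPred_eq]
    constructor
    · intro h
      obtain ⟨_, ⟨s, rfl⟩, rfl⟩ := haarGraph_adj_inl_inr.mp (hF h)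
      exact ⟨s, h, rfl⟩
    · rintro ⟨s, h, hs⟩
      rwa [← hs]

theorem ncard_neighborSet_inr_of_le {m : ℕ} {c : Fin 3 → ZMod m} (hc : Function.Injective c)
    {F : SimpleGraph (ZMod m ⊕ ZMod m)} (hF : F ≤ haarGraph m (Set.range c)) (y : ZMod m) :
    (F.neighborSet (Sum.inr y)).ncard = {s | F.Adj (Sum.inl (y - c s)) (Sum.inr y)}.ncard := by
  rw [← Set.ncard_image_of_injective (f := fun s => (Sum.inl (y - c s) : ZMod m ⊕ ZMod m))
    _ fun s t h => hc (sub_right_injective (Sum.inl_injective h))]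
  congr 1
  ext (x | x)
  · simp only [mem_neighborSet, Set.mem_image, Set.mem_ofPred_eq]
    constructor
    · intro h
      obtain ⟨_, ⟨s, rfl⟩, rfl⟩ := haarGraph_adj_inl_inr.mp (hF h.symm)
      exact ⟨s, by simpa using h.symm, by simp⟩
    · rintro ⟨s, h, hs⟩
      rw [← hs]
      exact h.symm
  · simpa using fun h => haarGraph_not_adj_inr_inr (hF h)

theorem haarGraph_isRegularOfDegree {m : ℕ} [NeZero m] {c : Fin 3 → ZMod m}
    (hc : Function.Injective c) [DecidableRel (haarGraph m (Set.range c)).Adj] :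
    (haarGraph m (Set.range c)).IsRegularOfDegree 3 := by
  intro v
  rw [← card_neighborSet_eq_degree, ← Nat.card_eq_fintype_card, Nat.card_coe_set_eq]
  rcases v with x | y
  · rw [ncard_neighborSet_inl_of_le hc le_rfl]
    simp [haarGraph_adj_inl_inr]
  · have huniv : {s | (haarGraph m (Set.range c)).Adj (Sum.inl (y - c s)) (Sum.inr y)} = Set.univ :=
      Set.eq_univ_of_forall fun s =>
        haarGraph_adj_inl_inr.mpr ⟨c s, ⟨s, rfl⟩, (sub_add_cancel y _).symm⟩
    rw [ncard_neighborSet_inr_of_le hc le_rfl, huniv]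
    simp

/-- Given the perfect matching that joins `u_x` to `v_{x + c (μ x)}`, the vertices `u_x` and `u_y`
are linked when they have a common neighbour along edges outside the matching. -/
def Linked {A : Type*} [Add A] (c : Fin 3 → A) (μ : A → Fin 3) (x y : A) : Prop :=
  ∃ s t, s ≠ μ x ∧ t ≠ μ y ∧ x + c s = y + c t

/-- The edges from `u_x` to `v_{x + c (μ x)}` form a matching, and deleting it leaves the vertices
`u_x` in one connected component. -/
structure IsCohamiltonian {A : Type*} [Add A] (c : Fin 3 → A) (μ : A → Fin 3) : Prop where
  injective : Function.Injective fun x => x + c (μ x)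
  eqvGen : ∀ x y, Relation.EqvGen (Linked c μ) x y

theorem IsCohamiltonian.isHamiltonian {m : ℕ} [NeZero m] {c : Fin 3 → ZMod m}
    (hc : Function.Injective c) {μ : ZMod m → Fin 3} (hμ : IsCohamiltonian c μ) :
    (haarGraph m (Set.range c)).IsHamiltonian := by
  let F : SimpleGraph (ZMod m ⊕ ZMod m) := SimpleGraph.fromRel fun p q =>
    match p, q with
    | Sum.inl x, Sum.inr y => ∃ s, s ≠ μ x ∧ y = x + c s
    | _, _ => False
  have hadj {x y : ZMod m} : F.Adj (Sum.inl x) (Sum.inr y) ↔ ∃ s, s ≠ μ x ∧ y = x + c s := by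
    simp [F]
  have hF : F ≤ haarGraph m (Set.range c) := by
    rintro (x | x) (y | y) h
    · simp [F] at h
    · obtain ⟨s, -, hs⟩ := hadj.mp h
      exact haarGraph_adj_inl_inr.mpr ⟨_, ⟨s, rfl⟩, hs⟩
    · obtain ⟨s, -, hs⟩ := hadj.mp h.symm
      exact Adj.symm (haarGraph_adj_inl_inr.mpr ⟨_, ⟨s, rfl⟩, hs⟩)
    · simp [F] at h
  have hcompl (s : Fin 3) : ({s}ᶜ : Set (Fin 3)).ncard = 2 := by
    rw [Set.ncard_compl]
    simp
  have hinl (x : ZMod m) : {s | F.Adj (Sum.inl x) (Sum.inr (x + c s))} = {μ x}ᶜ := by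
    ext s
    simp [hadj, hc.eq_iff]
  have hinr (y : ZMod m) : ∃ t, {s | F.Adj (Sum.inl (y - c s)) (Sum.inr y)} = {t}ᶜ := by
    obtain ⟨x, rfl⟩ := (Finite.injective_iff_surjective.mp hμ.injective) y
    refine ⟨μ x, ?_⟩
    ext s
    have hs : F.Adj (Sum.inl (x + c (μ x) - c s)) (Sum.inr (x + c (μ x))) ↔
        s ≠ μ (x + c (μ x) - c s) := by
      rw [hadj]
      constructor
      · rintro ⟨t, ht, h⟩
        obtain rfl : s = t := by
          refine hc (add_left_cancel (a := x + c (μ x) - c s) ?_)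
          rw [sub_add_cancel, ← h]
        exact ht
      · exact fun h => ⟨s, h, by simp⟩
    simp only [Set.mem_ofPred_eq, hs, Set.mem_compl_iff, Set.mem_singleton_iff]
    refine not_congr ⟨fun h => ?_, fun h => by simp [h]⟩
    have := hμ.injective (a₁ := x + c (μ x) - c s) (a₂ := x) (by simp [← h])
    rwa [this] at h
  have h2 (v) : (F.neighborSet v).ncard = 2 := by
    rcases v with x | y
    · rw [ncard_neighborSet_inl_of_le hc hF, hinl, hcompl]
    · obtain ⟨t, ht⟩ := hinr y
      rw [ncard_neighborSet_inr_of_le hc hF, ht, hcompl]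
  have hreach (x y : ZMod m) : F.Reachable (Sum.inl x) (Sum.inl y) := by
    induction hμ.eqvGen x y with
    | rel x y h =>
      obtain ⟨s, t, hs, ht, h⟩ := h
      exact (hadj.mpr ⟨s, hs, rfl⟩).reachable.trans (hadj.mpr ⟨t, ht, h⟩).symm.reachable
    | refl x => rfl
    | symm x y _ h => exact h.symm
    | trans x y z _ _ h h' => exact h.trans h'
  have hconn : F.Connected := by
    rw [connected_iff_exists_forall_reachable]
    refine ⟨Sum.inl 0, ?_⟩
    rintro (x | y)
    · exact hreach 0 x
    · obtain ⟨t, ht⟩ := hinr y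
      obtain ⟨s, hs⟩ := exists_ne t
      have : s ∈ ({t}ᶜ : Set (Fin 3)) := hs
      rw [← ht] at this
      exact (hreach 0 _).trans this.reachable
  exact (isHamiltonian_of_connected_of_ncard_neighborSet hconn h2).mono hF

theorem exists_isCohamiltonian_of_le {m : ℕ} {c : Fin 3 → ZMod m}
    (hc : Function.Injective c) {F : SimpleGraph (ZMod m ⊕ ZMod m)}
    (hF : F ≤ haarGraph m (Set.range c)) (hconn : F.Connected)
    (h2 : ∀ v, (F.neighborSet v).ncard = 2) :
    ∃ μ, IsCohamiltonian c μ ∧ ∀ x s, s ≠ μ x ↔ F.Adj (Sum.inl x) (Sum.inr (x + c s)) := by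
  have hcompl {T : Set (Fin 3)} (hT : T.ncard = 2) : ∃ s, T = {s}ᶜ := by
    obtain ⟨s, hs⟩ := Set.ncard_eq_one.mp (show (Tᶜ).ncard = 1 by rw [Set.ncard_compl, hT]; simp)
    exact ⟨s, by rw [← hs, compl_compl]⟩
  have hinl (x : ZMod m) := hcompl ((ncard_neighborSet_inl_of_le hc hF x).symm.trans (h2 _))
  have hinr (y : ZMod m) := hcompl ((ncard_neighborSet_inr_of_le hc hF y).symm.trans (h2 _))
  choose μ hμ using hinl
  choose ν hν using hinr
  have hμ' (x s) : s ≠ μ x ↔ F.Adj (Sum.inl x) (Sum.inr (x + c s)) :=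
    (Set.ext_iff.mp (hμ x) s).symm
  have hν' (y s) : s ≠ ν y ↔ F.Adj (Sum.inl (y - c s)) (Sum.inr y) :=
    (Set.ext_iff.mp (hν y) s).symm
  have hμν (x) : μ x = ν (x + c (μ x)) := by
    by_contra h
    rw [← ne_eq, hν', add_sub_cancel_right, ← hμ'] at h
    exact h rfl
  refine ⟨μ, ⟨fun x y h => ?_, fun x y => ?_⟩, hμ'⟩
  · have hxy : μ x = μ y := by rw [hμν x, hμν y]; exact congrArg ν h
    simpa [hxy] using h
  · have hnbr (y) : ∃ x, F.Adj (Sum.inl x) (Sum.inr y) := by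
      obtain ⟨s, hs⟩ := exists_ne (ν y)
      exact ⟨_, (hν' y s).mp hs⟩
    choose r hr using hnbr
    have hlinked {x x' y} (h : F.Adj (Sum.inl x) (Sum.inr y))
        (h' : F.Adj (Sum.inl x') (Sum.inr y)) : Relation.EqvGen (Linked c μ) x x' := by
      obtain ⟨_, ⟨s, rfl⟩, rfl⟩ := haarGraph_adj_inl_inr.mp (hF h)
      obtain ⟨_, ⟨t, rfl⟩, ht⟩ := haarGraph_adj_inl_inr.mp (hF h')
      refine .rel _ _ ⟨s, t, (hμ' _ _).mpr h, (hμ' _ _).mpr ?_, ht⟩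
      rwa [← ht]
    let rep : ZMod m ⊕ ZMod m → ZMod m := Sum.elim id r
    have hstep {p q} (h : F.Adj p q) : Relation.EqvGen (Linked c μ) (rep p) (rep q) := by
      rcases p with p | p <;> rcases q with q | q
      · exact (haarGraph_not_adj_inl_inl (hF h)).elim
      · exact hlinked h (hr q)
      · exact hlinked (hr p) h.symm
      · exact (haarGraph_not_adj_inr_inr (hF h)).elim
    obtain ⟨w⟩ := hconn.preconnected (Sum.inl x) (Sum.inl y)
    have hwalk {p q} (w : F.Walk p q) : Relation.EqvGen (Linked c μ) (rep p) (rep q) := by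
      induction w with
      | nil => exact .refl _
      | cons h _ ih => exact (hstep h).trans _ _ _ ih
    exact hwalk w

/-- The closed enumeration `u_0, v_1, u_1, v_2, …` of the vertices of a cyclic Haar graph. -/
theorem exists_alternating_enum {n k : ℕ} [NeZero n] (hk : k + 3 = 2 * n) :
    ∃ f : Fin (k + 3) ≃ ZMod n ⊕ ZMod n, ∀ i,
      (∃ x, f i = Sum.inl x ∧ f (i + 1) = Sum.inr (x + 1)) ∨
      (∃ x, f i = Sum.inr x ∧ f (i + 1) = Sum.inl x) := by
  let g (i : Fin (k + 3)) : ZMod n ⊕ ZMod n :=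
    if i.val % 2 = 0 then Sum.inl ((i.val / 2 : ℕ) : ZMod n)
    else Sum.inr ((i.val / 2 : ℕ) + 1 : ZMod n)
  have hcast {i j : ℕ} (hi : i < k + 3) (hj : j < k + 3)
      (h : ((i / 2 : ℕ) : ZMod n) = ((j / 2 : ℕ) : ZMod n)) : i / 2 = j / 2 := by
    rw [ZMod.natCast_eq_natCast_iff', Nat.mod_eq_of_lt (by omega),
      Nat.mod_eq_of_lt (by omega)] at h
    exact h
  have hg : Function.Bijective g := by
    rw [Fintype.bijective_iff_injective_and_card]
    refine ⟨fun i j h => ?_, by simp [ZMod.card]; omega⟩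
    simp only [g] at h
    ext
    split_ifs at h
    · have := hcast i.2 j.2 (Sum.inl_injective h)
      omega
    · have := hcast i.2 j.2 (add_right_cancel (Sum.inr_injective h))
      omega
  refine ⟨Equiv.ofBijective g hg, fun i => ?_⟩
  have hi := i.2
  have hval : (i + 1).val = if i.val + 1 = k + 3 then 0 else i.val + 1 := by
    rw [Fin.val_add_one]
    simp [Fin.ext_iff]
  simp only [Equiv.ofBijective_apply, g, hval]
  by_cases h : i.val % 2 = 0
  · left
    simp only [if_pos h, if_neg (show i.val + 1 ≠ k + 3 by omega),
      if_neg (show (i.val + 1) % 2 ≠ 0 by omega), show (i.val + 1) / 2 = i.val / 2 by omega]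
    exact ⟨_, rfl, rfl⟩
  · right
    refine ⟨_, if_neg h, ?_⟩
    have hsucc : ((i.val / 2 : ℕ) : ZMod n) + 1 = ((i.val / 2 + 1 : ℕ) : ZMod n) := by push_cast; rfl
    by_cases h1 : i.val + 1 = k + 3
    · rw [hsucc, show i.val / 2 + 1 = n by omega]
      simp [h1]
    · rw [if_neg h1, if_pos (by omega), hsucc, show i.val / 2 + 1 = (i.val + 1) / 2 by omega]

theorem exists_isCohamiltonian_of_ne {n : ℕ} [NeZero n] {e : ZMod n} (h01 : (1 : ZMod n) ≠ 0)
    (he0 : e ≠ 0) (he1 : e ≠ 1) :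
    ∃ μ : ZMod n → Fin 3, IsCohamiltonian ![0, 1, e] μ ∧ ∃ x, μ x ≠ 2 := by
  classical
  have hc : Function.Injective ![0, 1, e] := by
    intro i j h
    fin_cases i <;> fin_cases j <;> simp_all [eq_comm]
  obtain ⟨k, hk⟩ : ∃ k, k + 3 = 2 * n := by
    have : n ≠ 1 := by
      rintro rfl
      exact h01 (Subsingleton.elim _ _)
    have := NeZero.ne n
    exact ⟨2 * n - 3, by omega⟩
  obtain ⟨f, hf⟩ := exists_alternating_enum hk
  have hstep (i) : (haarGraph n (Set.range ![0, 1, e])).Adj (f i) (f (i + 1)) := by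
    rcases hf i with ⟨x, h, h'⟩ | ⟨x, h, h'⟩ <;> rw [h, h']
    · exact haarGraph_adj_inl_inr.mpr ⟨1, ⟨1, rfl⟩, rfl⟩
    · exact Adj.symm (haarGraph_adj_inl_inr.mpr ⟨0, ⟨0, rfl⟩, (add_zero x).symm⟩)
  have hcyc (i) : (enumCycle f).Adj (f i) (f (i + 1)) := by
    rw [comap_adj, cycleGraph_adj]
    simp
  obtain ⟨F, hF, hconn, h2, p, q, hpq, hnot⟩ :=
    exists_second_hamiltonian_cycle _ (haarGraph_isRegularOfDegree hc) f
      (fun i j hij => by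
        have hj : j = i + 1 := by
          ext
          rw [Fin.val_add_one, if_neg (by rintro rfl; have := j.2; simp at hij; omega), hij]
        exact hj ▸ hstep i)
      (by simpa using hstep (Fin.last _))
  obtain ⟨μ, hμ, hadj⟩ := exists_isCohamiltonian_of_le hc hF hconn h2
  refine ⟨μ, hμ, ?_⟩
  have key {x y} (h : F.Adj (Sum.inl x) (Sum.inr y))
      (h' : ¬(enumCycle f).Adj (Sum.inl x) (Sum.inr y)) : μ x ≠ 2 := by
    obtain ⟨_, ⟨s, rfl⟩, rfl⟩ := haarGraph_adj_inl_inr.mp (hF h)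
    have hs := (hadj x s).mpr h
    contrapose! h'
    fin_cases s
    · obtain ⟨i, hi⟩ := f.surjective (Sum.inr x)
      rcases hf i with ⟨z, hz, hz'⟩ | ⟨z, hz, hz'⟩
      · simp [hi] at hz
      · obtain rfl : x = z := Sum.inr_injective (hi.symm.trans hz)
        have := hcyc i
        rw [hz, hz'] at this
        simpa using this.symm
    · obtain ⟨i, hi⟩ := f.surjective (Sum.inl x)
      rcases hf i with ⟨z, hz, hz'⟩ | ⟨z, hz, hz'⟩
      · obtain rfl : x = z := Sum.inl_injective (hi.symm.trans hz)
        have := hcyc i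
        rwa [hz, hz'] at this
      · simp [hi] at hz
    · exact absurd h'.symm hs
  rcases p with p | p <;> rcases q with q | q
  · exact (haarGraph_not_adj_inl_inl (hF hpq)).elim
  · exact ⟨p, key hpq hnot⟩
  · exact ⟨q, key hpq.symm fun h => hnot h.symm⟩
  · exact (haarGraph_not_adj_inr_inr (hF hpq)).elim

theorem eqvGen_of_forall_add_one {n : ℕ} [NeZero n] {r : ZMod n → ZMod n → Prop}
    (h : ∀ x, r x (x + 1)) (x y : ZMod n) : Relation.EqvGen r x y := by
  have h0 (z : ℕ) : Relation.EqvGen r 0 z := by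
    induction z with
    | zero => simpa using .refl _
    | succ z ih => simpa using ih.trans _ _ _ (.rel _ _ (h z))
  have hx := h0 x.val
  have hy := h0 y.val
  rw [ZMod.natCast_zmod_val] at hx hy
  exact (hx.symm _ _).trans _ _ _ hy

theorem exists_isCohamiltonian_cyclic {n : ℕ} [NeZero n] (h01 : (1 : ZMod n) ≠ 0) (e : ZMod n) :
    ∃ μ : ZMod n → Fin 3, IsCohamiltonian ![0, 1, e] μ ∧ ∃ x, μ x ≠ 2 := by
  by_cases he0 : e = 0
  · subst he0
    refine ⟨fun x => if x = 0 then 0 else 2, ⟨fun x y h => ?_, ?_⟩, 0, by simp⟩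
    · have hzero (z : ZMod n) : ![(0 : ZMod n), 1, 0] (if z = 0 then 0 else 2) = 0 := by
        split_ifs <;> rfl
      simpa [hzero] using h
    · refine eqvGen_of_forall_add_one fun x => ?_
      refine ⟨1, if x + 1 = 0 then 2 else 0, ?_, ?_, ?_⟩ <;> (try dsimp only) <;> split_ifs <;> simp
  by_cases he1 : e = 1
  · subst he1
    refine ⟨fun x => if x = 0 then 1 else 2, ⟨fun x y h => ?_, ?_⟩, 0, by simp⟩
    · have hone (z : ZMod n) : ![(0 : ZMod n), 1, 1] (if z = 0 then 1 else 2) = 1 := by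
        split_ifs <;> rfl
      simpa [hone] using h
    · refine eqvGen_of_forall_add_one fun x => ?_
      refine ⟨if x = 0 then 2 else 1, 0, ?_, ?_, ?_⟩ <;> (try dsimp only) <;> split_ifs <;> simp
  exact exists_isCohamiltonian_of_ne h01 he0 he1

section Lifting

variable {A : Type*} [AddCommGroup A] [Finite A] {n k : ℕ} [NeZero n] {a b : A}

theorem exists_isCohamiltonian_of_odd_index (ι : ZMod n →+ A) (hι : Function.Injective ι)
    (ha : ι 1 = a) (hk : Odd k)
    (hinj : ∀ j < k, ∀ j' < k, j • b - j' • b ∈ ι.range → j = j')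
    (hsurj : ∀ x, ∃ j < k, x - j • b ∈ ι.range) {e : ZMod n}
    (he : k • b - (k / 2) • a = ι e) {μ₀ : ZMod n → Fin 3}
    (hμ₀ : IsCohamiltonian ![0, 1, e] μ₀) (hne : ∃ x, μ₀ x ≠ 2) :
    ∃ μ : A → Fin 3, IsCohamiltonian ![0, a, b] μ := by
  let Φ (j : ℕ) (i : ZMod n) : A := j • b - (j / 2) • a + ι i
  have hmul (z : ℕ) : z • a ∈ ι.range := ι.range.nsmul_mem ⟨1, ha⟩ z
  have hΦinj {j j' i i'} (hj : j < k) (hj' : j' < k) (h : Φ j i = Φ j' i') :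
      j = j' ∧ i = i' := by
    obtain rfl : j = j' := by
      refine hinj j hj j' hj' ?_
      have h' : j • b - j' • b = (j / 2) • a - (j' / 2) • a + (ι i' - ι i) := by
        rw [← sub_eq_zero, ← sub_eq_zero.mpr h]
        simp only [Φ]
        abel
      rw [h']
      exact add_mem (sub_mem (hmul _) (hmul _)) (sub_mem ⟨i', rfl⟩ ⟨i, rfl⟩)
    exact ⟨rfl, hι (add_left_cancel h)⟩
  have hΦsurj (x) : ∃ j < k, ∃ i, Φ j i = x := by
    obtain ⟨j, hj, hx⟩ := hsurj x
    obtain ⟨i, hi⟩ := add_mem hx (hmul (j / 2))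
    refine ⟨j, hj, i, ?_⟩
    simp only [Φ, hi]
    abel
  have hΦa (j i) : Φ j i + a = Φ j (i + 1) := by
    simp only [Φ, map_add, ha]
    abel
  have hΦb_even {j} (hj : j % 2 = 0) (i) : Φ j i + b = Φ (j + 1) i := by
    simp only [Φ, show (j + 1) / 2 = j / 2 by omega, add_smul, one_smul]
    abel
  have hΦb_odd {j} (hj : j % 2 = 1) (i) : Φ j i + b = Φ (j + 1) (i + 1) := by
    simp only [Φ, show (j + 1) / 2 = j / 2 + 1 by omega, add_smul, one_smul, map_add, ha]
    abel
  have hΦk (i) : Φ k i = Φ 0 (i + e) := by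
    simp only [Φ, he, map_add]
    simp [add_comm]
  have hk2 := Nat.odd_iff.mp hk
  have hΦlast (i) : Φ (k - 1) i + b = Φ 0 (i + e) := by
    rw [hΦb_even (by omega), Nat.sub_add_cancel (by omega), hΦk]
  let col (j : ℕ) (i : ZMod n) : Fin 3 :=
    if j = 0 then μ₀ i else if μ₀ i = 2 then 2 else if j % 2 = 1 then 0 else 1
  obtain ⟨μ, hμ⟩ : ∃ μ : A → Fin 3, ∀ j < k, ∀ i, μ (Φ j i) = col j i := by
    choose J hJ I hI using hΦsurj
    refine ⟨fun x => col (J x) (I x), fun j hj i => ?_⟩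
    obtain ⟨h1, h2⟩ := hΦinj (hJ _) hj (hI (Φ j i))
    simp only [h1, h2]
  have hcol_zero (i) : col 0 i = μ₀ i := if_pos rfl
  have hcol_two {j i} (h : μ₀ i = 2) : col j i = 2 := by
    simp [col, h]
  have hcol_odd {j i} (hj : j % 2 = 1) (h : μ₀ i ≠ 2) : col j i = 0 := by
    simp [col, h, hj, show j ≠ 0 by omega]
  have hcol_even {j i} (hj : j % 2 = 0) (hj0 : 0 < j) (h : μ₀ i ≠ 2) : col j i = 1 := by
    simp [col, h, hj, hj0.ne']
  have hcol_odd_ne {j i} (hj : j % 2 = 1) : col j i ≠ 1 := by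
    by_cases h : μ₀ i = 2
    · simp [hcol_two h]
    · simp [hcol_odd hj h]
  have hcol_even_ne {j i} (hj : j % 2 = 0) (hj0 : 0 < j) : col j i ≠ 0 := by
    by_cases h : μ₀ i = 2
    · simp [hcol_two h]
    · simp [hcol_even hj hj0 h]
  have hcol_ne_two {j i} (h : μ₀ i ≠ 2) : col j i ≠ 2 := by
    rcases Nat.eq_zero_or_pos j with rfl | hj0
    · rwa [hcol_zero]
    · rcases Nat.mod_two_eq_zero_or_one j with hj | hj
      · simp [hcol_even hj hj0 h]
      · simp [hcol_odd hj h]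
  refine ⟨μ, ⟨Finite.injective_iff_surjective.mpr fun y => ?_, ?_⟩⟩
  · obtain ⟨j, hj, i, rfl⟩ := hΦsurj y
    have hsucc {j i} (hj : j + 1 < k) (hj2 : j % 2 = 0) (h : μ₀ i = 2) :
        Φ j i + ![0, a, b] (μ (Φ j i)) = Φ (j + 1) i := by
      rw [hμ j (by omega), hcol_two h]
      exact hΦb_even hj2 i
    rcases Nat.eq_zero_or_pos j with rfl | hj0
    · obtain ⟨i', rfl⟩ := (Finite.injective_iff_surjective.mp hμ₀.injective) i
      by_cases h : μ₀ i' = 2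
      · refine ⟨Φ (k - 1) i', ?_⟩
        simp only [hμ (k - 1) (by omega), hcol_two h, h]
        exact hΦlast i'
      · refine ⟨Φ 0 i', ?_⟩
        simp only [hμ 0 hj, hcol_zero]
        generalize μ₀ i' = s at h
        fin_cases s
        · simp
        · exact hΦa 0 i'
        · exact absurd rfl h
    · rcases Nat.mod_two_eq_zero_or_one j with hj2 | hj2
      · by_cases h : μ₀ (i - 1) = 2
        · refine ⟨Φ (j - 1) (i - 1), ?_⟩
          simp only [hμ (j - 1) (by omega), hcol_two h]
          refine (hΦb_odd (by omega) _).trans ?_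
          rw [Nat.sub_add_cancel hj0, sub_add_cancel]
        · refine ⟨Φ j (i - 1), ?_⟩
          simp only [hμ j hj, hcol_even hj2 hj0 h]
          exact (hΦa _ _).trans (by rw [sub_add_cancel])
      · by_cases h : μ₀ i = 2
        · refine ⟨Φ (j - 1) i, ?_⟩
          simp only [hμ (j - 1) (by omega), hcol_two h]
          refine (hΦb_even (by omega) _).trans ?_
          rw [Nat.sub_add_cancel hj0]
        · refine ⟨Φ j i, ?_⟩
          simp only [hμ j hj, hcol_odd hj2 h]
          exact add_zero _
  · let L (j : ℕ) (i : ZMod n) (j' : ℕ) (i' : ZMod n) : Prop :=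
      Relation.EqvGen (Linked ![0, a, b] μ) (Φ j i) (Φ j' i')
    have hlink {j i j' i'} (s t : Fin 3) (hj : j < k) (hj' : j' < k) (hs : s ≠ col j i)
        (ht : t ≠ col j' i') (h : Φ j i + ![0, a, b] s = Φ j' i' + ![0, a, b] t) : L j i j' i' :=
      .rel _ _ ⟨s, t, by rwa [hμ j hj], by rwa [hμ j' hj'], h⟩
    have step_down {j i} (hj : j < k) (hj2 : j % 2 = 1) (h : μ₀ i = 2) : L j i j (i - 1) :=
      hlink 0 1 hj hj (by simp [hcol_two h]) (hcol_odd_ne hj2).symm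
        ((add_zero _).trans (by rw [show ![0, a, b] 1 = a from rfl, hΦa, sub_add_cancel]))
    have step_up {j i} (hj : j < k) (hj0 : 0 < j) (hj2 : j % 2 = 0) (h : μ₀ i = 2) :
        L j i j (i + 1) :=
      hlink 1 0 hj hj (by simp [hcol_two h]) (hcol_even_ne hj2 hj0).symm
        ((hΦa _ _).trans (add_zero _).symm)
    have exit_odd {j i} (hj : j < k) (hj2 : j % 2 = 1) (h : μ₀ i ≠ 2) :
        L j i (j + 1) (i + 1) :=
      hlink 2 0 hj (by omega) (hcol_ne_two h).symm (hcol_even_ne (by omega) (by omega)).symm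
        ((hΦb_odd hj2 _).trans (add_zero _).symm)
    have exit_even {j i} (hj : j + 1 < k) (hj2 : j % 2 = 0) (h : μ₀ i ≠ 2) :
        L j i (j + 1) (i - 1) :=
      hlink 2 1 (by omega) hj (hcol_ne_two h).symm (hcol_odd_ne (by omega)).symm
        ((hΦb_even hj2 _).trans
          (by rw [show ![0, a, b] 1 = a from rfl, hΦa, sub_add_cancel]))
    have walk_down {j} (hj : j < k) (hj2 : j % 2 = 1) (i : ZMod n) (h : ℕ)
        (hh : ∀ h' < h, μ₀ (i - h') = 2) : L j i j (i - h) := by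
      induction h with
      | zero => simpa using .refl _
      | succ h ih =>
        have h1 := ih fun h' hlt => hh h' (by omega)
        have h2 := step_down hj hj2 (hh h (by omega))
        rw [sub_sub, ← Nat.cast_succ] at h2
        exact h1.trans _ _ _ h2
    have walk_up {j} (hj : j < k) (hj0 : 0 < j) (hj2 : j % 2 = 0) (i : ZMod n) (h : ℕ)
        (hh : ∀ h' < h, μ₀ (i + h') = 2) : L j i j (i + h) := by
      induction h with
      | zero => simpa using .refl _
      | succ h ih =>
        have h1 := ih fun h' hlt => hh h' (by omega)
        have h2 := step_up hj hj0 hj2 (hh h (by omega))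
        rw [add_assoc, ← Nat.cast_succ] at h2
        exact h1.trans _ _ _ h2
    obtain ⟨x₀, hx₀⟩ := hne
    have exists_down (i : ZMod n) :
        ∃ h : ℕ, μ₀ (i - h) ≠ 2 ∧ ∀ h' < h, μ₀ (i - h') = 2 := by
      have hex : ∃ h : ℕ, μ₀ (i - h) ≠ 2 := ⟨(i - x₀).val, by simpa using hx₀⟩
      exact ⟨Nat.find hex, Nat.find_spec hex, fun h' hlt => not_not.mp (Nat.find_min hex hlt)⟩
    have exists_up (i : ZMod n) :
        ∃ h : ℕ, μ₀ (i + h) ≠ 2 ∧ ∀ h' < h, μ₀ (i + h') = 2 := by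
      have hex : ∃ h : ℕ, μ₀ (i + h) ≠ 2 := ⟨(x₀ - i).val, by simpa using hx₀⟩
      exact ⟨Nat.find hex, Nat.find_spec hex, fun h' hlt => not_not.mp (Nat.find_min hex hlt)⟩
    have two_layers {j i} (hj : j + 2 < k) (hj2 : j % 2 = 0) (h : μ₀ i ≠ 2) : L j i (j + 2) i := by
      obtain ⟨g, hg, hmin⟩ := exists_down (i - 1)
      have h1 := exit_even (by omega) hj2 h
      have h2 := walk_down (j := j + 1) (by omega) (by omega) (i - 1) g hmin
      have h3 := exit_odd (j := j + 1) (by omega) (by omega) hg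
      have h4 := walk_up hj (by omega) (by omega) (i - 1 - g + 1) g fun h' hlt => by
        rw [← hmin (g - 1 - h') (by omega), Nat.sub_sub, Nat.cast_sub (by omega)]
        congr 1
        push_cast
        ring
      rw [show i - 1 - g + 1 + g = i by ring] at h4
      exact ((h1.trans _ _ _ h2).trans _ _ _ h3).trans _ _ _ h4
    have all_layers {i} (h : μ₀ i ≠ 2) (q : ℕ) (hq : 2 * q < k) : L 0 i (2 * q) i := by
      induction q with
      | zero => exact .refl _
      | succ q ih => exact (ih (by omega)).trans _ _ _ (two_layers hq (by omega) h)
    have from_base {x s} (hs : s ≠ μ₀ x) : ∃ w t, t ≠ μ w ∧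
        w + ![0, a, b] t = Φ 0 (x + ![0, 1, e] s) ∧
        Relation.EqvGen (Linked ![0, a, b] μ) (Φ 0 x) w := by
      have hμx : μ (Φ 0 x) = μ₀ x := by rw [hμ 0 (by omega), hcol_zero]
      fin_cases s
      · exact ⟨Φ 0 x, 0, by rwa [hμx], by simp, .refl _⟩
      · exact ⟨Φ 0 x, 1, by rwa [hμx], hΦa 0 x, .refl _⟩
      · refine ⟨Φ (k - 1) x, 2, ?_, hΦlast x, ?_⟩
        · rw [hμ _ (by omega)]
          exact (hcol_ne_two hs.symm).symm
        · have := all_layers hs.symm ((k - 1) / 2) (by omega)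
          rwa [Nat.mul_div_cancel' (Nat.dvd_of_mod_eq_zero (by omega))] at this
    have base (x y) : L 0 x 0 y := by
      induction hμ₀.eqvGen x y with
      | rel x y h =>
        obtain ⟨s, t, hs, ht, h⟩ := h
        obtain ⟨w, s', hs', hw, hxw⟩ := from_base hs
        obtain ⟨w', t', ht', hw', hyw'⟩ := from_base ht
        refine (hxw.trans _ _ _ (.rel _ _ ⟨s', t', hs', ht', ?_⟩)).trans _ _ _ (hyw'.symm _ _)
        rw [hw, hw', h]
      | refl x => exact .refl _
      | symm x y _ h => exact h.symm _ _
      | trans x y z _ _ h h' => exact h.trans _ _ _ h'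
    have even_layer {j} (hj : j < k) (hj2 : j % 2 = 0) (i) : ∃ i', L 0 i' j i := by
      rcases Nat.eq_zero_or_pos j with rfl | hj0
      · exact ⟨i, .refl _⟩
      · obtain ⟨h, hh, hmin⟩ := exists_up i
        have h1 := all_layers hh (j / 2) (by omega)
        rw [Nat.mul_div_cancel' (Nat.dvd_of_mod_eq_zero hj2)] at h1
        exact ⟨_, h1.trans _ _ _ ((walk_up hj hj0 hj2 i h hmin).symm _ _)⟩
    have any_layer {j} (hj : j < k) (i) : ∃ i', L 0 i' j i := by
      rcases Nat.mod_two_eq_zero_or_one j with hj2 | hj2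
      · exact even_layer hj hj2 i
      · obtain ⟨h, hh, hmin⟩ := exists_down i
        obtain ⟨i', hi'⟩ := even_layer (j := j + 1) (by omega) (by omega) (i - h + 1)
        exact ⟨i', (hi'.trans _ _ _ ((exit_odd hj hj2 hh).symm _ _)).trans _ _ _
          ((walk_down hj hj2 i h hmin).symm _ _)⟩
    intro x y
    obtain ⟨j, hj, i, rfl⟩ := hΦsurj x
    obtain ⟨j', hj', i', rfl⟩ := hΦsurj y
    obtain ⟨p, hp⟩ := any_layer hj i
    obtain ⟨q, hq⟩ := any_layer hj' i'
    exact ((hp.symm _ _).trans _ _ _ (base p q)).trans _ _ _ hq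

end Lifting

theorem exists_isCohamiltonian_of_even_index {A : Type*} [AddCommGroup A] [Finite A] {a b : A}
    (hgen : ∀ x, ∃ p q : ℤ, x = p • a + q • b)
    (hodd : ∀ p q : ℤ, p • a + (2 * q + 1) • b ≠ 0) :
    ∃ μ : A → Fin 3, IsCohamiltonian ![0, a, b] μ := by
  classical
  let d : A := (2 : ℤ) • b - a
  let D : AddSubgroup A := AddSubgroup.zmultiples d
  have hbd : b + b = d + a := by simp only [d, two_smul]; abel
  have hdD : d ∈ D := AddSubgroup.mem_zmultiples d
  let Ev (x : A) : Prop := ∃ p q : ℤ, x = p • a + (2 * q) • b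
  have hEv_add {x} (h : Ev x) (z : ℤ) : Ev (x + z • a) := by
    obtain ⟨p, q, rfl⟩ := h
    exact ⟨p + z, q, by rw [add_smul]; abel⟩
  have hEv_D {x} (h : x ∈ D) : Ev x := by
    obtain ⟨z, rfl⟩ := AddSubgroup.mem_zmultiples_iff.mp h
    refine ⟨-z, z, ?_⟩
    simp only [d, smul_sub, neg_smul, mul_smul, smul_comm z (2 : ℤ) b]
    abel
  have hEv_b {x} (h : Ev x) : ¬Ev (x - b) := by
    rintro ⟨p', q', h'⟩
    obtain ⟨p, q, rfl⟩ := h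
    refine hodd (p' - p) (q' - q) ?_
    rw [← sub_eq_zero.mpr h'.symm]
    simp only [mul_sub, sub_smul, add_smul, one_smul]
    abel
  have hEv_or (x) : Ev x ∨ Ev (x - b) := by
    obtain ⟨p, q, rfl⟩ := hgen x
    rcases Int.even_or_odd' q with ⟨r, rfl | rfl⟩
    · exact .inl ⟨p, r, rfl⟩
    · exact .inr ⟨p, r, by rw [add_smul, one_smul]; abel⟩
  have hexit {x} (h : Ev x) : ∃ z : ℤ, x + z • a ∈ D := by
    obtain ⟨p, q, rfl⟩ := h
    refine ⟨-(p + q), ?_⟩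
    convert D.zsmul_mem hdD q using 1
    simp only [d, smul_sub, neg_smul, add_smul, mul_smul, smul_comm q (2 : ℤ) b]
    abel
  have hnat (z : ℤ) : ∃ h : ℕ, h • a = z • a :=
    mem_multiples_iff_mem_zmultiples.mpr (AddSubgroup.mem_zmultiples_iff.mpr ⟨z, rfl⟩)
  let μ (x : A) : Fin 3 := if x ∈ D then 1 else if x - b ∈ D then 0 else 2
  have hμ_even {x} (h : x ∈ D) : μ x = 1 := if_pos h
  have hμ_odd {x} (h : x - b ∈ D) : μ x = 0 := by
    simp [μ, h, show x ∉ D from fun hx => hEv_b (hEv_D hx) (hEv_D h)]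
  have hμ_ne_one {x} (h : x ∉ D) : 1 ≠ μ x := by
    by_cases h' : x - b ∈ D <;> simp [μ, h, h']
  have hμ_ne_zero {x} (h : x - b ∉ D) : 0 ≠ μ x := by
    by_cases h' : x ∈ D <;> simp [μ, h, h']
  refine ⟨μ, ⟨Finite.injective_iff_surjective.mpr fun y => ?_, ?_⟩⟩
  · have hsub : y - b - b ∈ D ↔ y - a ∈ D := by
      rw [sub_sub, hbd, add_comm, ← sub_sub]
      exact ⟨fun h => by simpa using D.add_mem h hdD, fun h => D.sub_mem h hdD⟩
    by_cases h1 : y - a ∈ D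
    · exact ⟨y - a, by simp [hμ_even h1]⟩
    · by_cases h2 : y - b ∈ D
      · exact ⟨y, by simp [hμ_odd h2]⟩
      · exact ⟨y - b, by simp [μ, h2, hsub, h1]⟩
  · let L : A → A → Prop := Relation.EqvGen (Linked ![0, a, b] μ)
    have step_up {x} (hx : Ev x) (h : x ∉ D) : L x (x + a) := by
      refine .rel _ _ ⟨1, 0, hμ_ne_one h, hμ_ne_zero fun h' => ?_, (add_zero _).symm⟩
      refine hEv_b ?_ (hEv_D h')
      simpa using hEv_add hx 1
    have step_down {x} (hx : Ev (x - b)) (h : x - b ∉ D) : L x (x - a) := by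
      refine .rel _ _ ⟨0, 1, hμ_ne_zero h, hμ_ne_one fun h' => ?_, by simp⟩
      refine hEv_b ?_ hx
      simpa using hEv_add (hEv_D h') 1
    have exit_even {x} (h : x ∈ D) : L x (x + b - a) := by
      refine .rel _ _ ⟨2, 1, by simp [hμ_even h], hμ_ne_one fun h' => ?_, by simp⟩
      refine hEv_b (x := x + b) (by simpa using hEv_add (hEv_D h') 1) ?_
      simpa using hEv_D h
    have exit_odd {x} (h : x - b ∈ D) : L x (x + b) := by
      refine .rel _ _ ⟨2, 0, by simp [hμ_odd h], hμ_ne_zero fun h' => ?_, by simp⟩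
      rw [add_sub_cancel_right] at h'
      exact hEv_b (hEv_D h') (hEv_D h)
    have walk_up {x} (hx : Ev x) (h : ℕ) (hh : ∀ h' < h, x + h' • a ∉ D) : L x (x + h • a) := by
      induction h with
      | zero => simpa using .refl _
      | succ h ih =>
        have h1 := ih fun h' hlt => hh h' (by omega)
        have h2 := step_up (by simpa using hEv_add hx h) (hh h (by omega))
        rw [add_assoc, ← succ_nsmul] at h2
        exact h1.trans _ _ _ h2
    have walk_down {x} (hx : Ev (x - b)) (h : ℕ) (hh : ∀ h' < h, x - h' • a - b ∉ D) :
        L x (x - h • a) := by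
      induction h with
      | zero => simpa using .refl _
      | succ h ih =>
        have h1 := ih fun h' hlt => hh h' (by omega)
        have hEv : Ev (x - h • a - b) := by
          rw [sub_right_comm]
          simpa [sub_eq_add_neg] using hEv_add hx (-h)
        have h2 := step_down hEv (hh h (by omega))
        rw [sub_sub, ← succ_nsmul] at h2
        exact h1.trans _ _ _ h2
    have exists_up {x} (hx : Ev x) : ∃ h : ℕ, x + h • a ∈ D ∧ ∀ h' < h, x + h' • a ∉ D := by
      obtain ⟨z, hz⟩ := hexit hx
      obtain ⟨h, hh⟩ := hnat z
      have hex : ∃ h : ℕ, x + h • a ∈ D := ⟨h, by rwa [hh]⟩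
      exact ⟨Nat.find hex, Nat.find_spec hex, fun h' hlt => Nat.find_min hex hlt⟩
    have exists_down {x} (hx : Ev (x - b)) :
        ∃ h : ℕ, x - h • a - b ∈ D ∧ ∀ h' < h, x - h' • a - b ∉ D := by
      obtain ⟨z, hz⟩ := hexit hx
      obtain ⟨h, hh⟩ := hnat (-z)
      have hex : ∃ h : ℕ, x - h • a - b ∈ D :=
        ⟨h, by rwa [hh, neg_smul, sub_neg_eq_add, add_sub_right_comm]⟩
      exact ⟨Nat.find hex, Nat.find_spec hex, fun h' hlt => Nat.find_min hex hlt⟩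
    have two_layers {x} (h : x ∈ D) : L x (x + d) := by
      have hEv : Ev (x + b - a - b) := by
        rw [show x + b - a - b = x - a by abel]
        simpa [sub_eq_add_neg] using hEv_add (hEv_D h) (-1)
      obtain ⟨g, hg, hmin⟩ := exists_down hEv
      have h1 := exit_even h
      have h2 := walk_down hEv g hmin
      have h3 := exit_odd hg
      have heq (u : A) : x + b - a - u + b = x + d - u := by
        rw [sub_add_eq_add_sub, sub_add_eq_add_sub, add_assoc x, hbd]
        abel
      rw [heq] at h3
      have hEv' : Ev (x + d - g • a) := by
        simpa [sub_eq_add_neg] using hEv_add (hEv_D (D.add_mem h hdD)) (-g)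
      have h4 := walk_up hEv' g fun h' hlt hmem => by
        refine hmin (g - 1 - h') (by omega) ?_
        have hsmul : (g - 1 - h') • a + (h' • a + a) = g • a := by
          rw [← succ_nsmul, ← add_smul]
          congr 1
          omega
        have : x + b - a - (g - 1 - h') • a - b = x + d - g • a + h' • a - d := by
          rw [← hsmul]
          abel
        rw [this]
        exact D.sub_mem hmem hdD
      rw [sub_add_cancel] at h4
      exact ((h1.trans _ _ _ h2).trans _ _ _ h3).trans _ _ _ h4
    have hD {x} (h : x ∈ D) : L 0 x := by
      obtain ⟨z, rfl : z • d = x⟩ := mem_multiples_iff_mem_zmultiples.mpr h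
      induction z with
      | zero => simpa using .refl _
      | succ z ih =>
        have hz := D.nsmul_mem hdD z
        rw [succ_nsmul]
        exact (ih hz).trans _ _ _ (two_layers hz)
    have hEv {x} (h : Ev x) : L 0 x := by
      obtain ⟨g, hg, hmin⟩ := exists_up h
      exact (hD hg).trans _ _ _ ((walk_up h g hmin).symm _ _)
    have hall (x) : L 0 x := by
      rcases hEv_or x with h | h
      · exact hEv h
      · obtain ⟨g, hg, hmin⟩ := exists_down h
        have hexit := exit_odd hg
        have hEv' : Ev (x - g • a + b) := by
          have := hEv_D (D.add_mem hg hdD)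
          have heq : x - g • a + b = x - g • a - b + d + (1 : ℤ) • a := by
            rw [one_smul, add_assoc, ← hbd]
            abel
          rw [heq]
          exact hEv_add this 1
        exact ((hEv hEv').trans _ _ _ (hexit.symm _ _)).trans _ _ _
          ((walk_down h g hmin).symm _ _)
    exact fun x y => ((hall x).symm _ _).trans _ _ _ (hall y)

theorem exists_isCohamiltonian {A : Type*} [AddCommGroup A] [Finite A] {a b : A} (ha : a ≠ 0)
    (hgen : ∀ x, ∃ p q : ℤ, x = p • a + q • b) :
    ∃ μ : A → Fin 3, IsCohamiltonian ![0, a, b] μ := by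
  let β : A ⧸ AddSubgroup.zmultiples a := b
  have hmem {z : ℤ} : z • b ∈ AddSubgroup.zmultiples a ↔ (addOrderOf β : ℤ) ∣ z := by
    rw [addOrderOf_dvd_iff_zsmul_eq_zero, ← QuotientAddGroup.eq_zero_iff]
    rfl
  rcases Nat.even_or_odd (addOrderOf β) with hk | hk
  · refine exists_isCohamiltonian_of_even_index hgen fun p q h => ?_
    have hdvd : (addOrderOf β : ℤ) ∣ 2 * q + 1 := by
      rw [← hmem, ← neg_eq_of_add_eq_zero_right h]
      exact neg_mem (zsmul_mem (AddSubgroup.mem_zmultiples a) p)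
    have : (2 : ℤ) ∣ 2 * q + 1 := (Int.natCast_dvd_natCast.mpr hk.two_dvd).trans hdvd
    omega
  · have : NeZero (addOrderOf a) := ⟨(addOrderOf_pos a).ne'⟩
    let ι : ZMod (addOrderOf a) →+ A :=
      ZMod.lift (addOrderOf a) ⟨zmultiplesHom A a, by simp [addOrderOf_nsmul_eq_zero]⟩
    have hι_coe (z : ℤ) : ι z = z • a := by simp [ι]
    have hι : Function.Injective ι := by
      rw [injective_iff_map_eq_zero]
      intro x hx
      obtain ⟨z, rfl⟩ := ZMod.intCast_surjective x
      rw [hι_coe, ← addOrderOf_dvd_iff_zsmul_eq_zero] at hx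
      exact (ZMod.intCast_zmod_eq_zero_iff_dvd _ _).mpr hx
    have hι_one : ι 1 = a := by simpa using hι_coe 1
    have hrange {x : A} : x ∈ ι.range ↔ x ∈ AddSubgroup.zmultiples a := by
      rw [AddMonoidHom.mem_range, AddSubgroup.mem_zmultiples_iff,
        (ZMod.intCast_surjective (n := addOrderOf a)).exists]
      simp only [hι_coe]
    have h01 : (1 : ZMod (addOrderOf a)) ≠ 0 := fun h => ha (by rw [← hι_one, h, map_zero])
    obtain ⟨e, he⟩ : addOrderOf β • b - (addOrderOf β / 2) • a ∈ ι.range := by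
      rw [hrange, ← natCast_zsmul b]
      exact sub_mem (hmem.mpr dvd_rfl) (nsmul_mem (AddSubgroup.mem_zmultiples a) _)
    obtain ⟨μ₀, hμ₀, hne⟩ := exists_isCohamiltonian_cyclic h01 e
    refine exists_isCohamiltonian_of_odd_index ι hι hι_one hk (fun j hj j' hj' h => ?_) (fun x => ?_)
      he.symm hμ₀ hne
    · rw [hrange, ← natCast_zsmul, ← natCast_zsmul, ← sub_smul, hmem] at h
      have := Int.eq_zero_of_abs_lt_dvd h (by rw [abs_lt]; omega)
      omega
    · obtain ⟨p, q, rfl⟩ := hgen x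
      have hpos : (0 : ℤ) < addOrderOf β := by
        exact_mod_cast hk.pos
      have hnonneg := Int.emod_nonneg q hpos.ne'
      refine ⟨(q % addOrderOf β).toNat, ?_, ?_⟩
      · have := Int.emod_lt_of_pos q hpos
        omega
      · rw [hrange, ← natCast_zsmul, Int.toNat_of_nonneg hnonneg, add_sub_assoc, ← sub_smul]
        exact add_mem (zsmul_mem (AddSubgroup.mem_zmultiples a) p)
          (hmem.mpr (Int.dvd_self_sub_emod))

theorem exists_eq_zsmul_add_zsmul_of_connected {m : ℕ} {a b : ZMod m}
    (hconn : (haarGraph m (Set.range ![0, a, b])).Connected) (x : ZMod m) :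
    ∃ p q : ℤ, x = p • a + q • b := by
  let H := AddSubgroup.closure {a, b}
  have hc (s) : ![0, a, b] s ∈ H := by
    fin_cases s
    · exact H.zero_mem
    · exact AddSubgroup.subset_closure (by simp)
    · exact AddSubgroup.subset_closure (by simp)
  have hstep {v w} (h : (haarGraph m (Set.range ![0, a, b])).Adj v w) :
      Sum.elim id id v ∈ H ↔ Sum.elim id id w ∈ H := by
    rcases v with v | v <;> rcases w with w | w
    · exact absurd h haarGraph_not_adj_inl_inl
    · obtain ⟨-, ⟨s, rfl⟩, rfl⟩ := haarGraph_adj_inl_inr.mp h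
      exact (H.add_mem_cancel_right (hc s)).symm
    · obtain ⟨-, ⟨s, rfl⟩, rfl⟩ := haarGraph_adj_inl_inr.mp h.symm
      exact H.add_mem_cancel_right (hc s)
    · exact absurd h haarGraph_not_adj_inr_inr
  have hwalk {v w} (p : (haarGraph m (Set.range ![0, a, b])).Walk v w) :
      Sum.elim id id v ∈ H ↔ Sum.elim id id w ∈ H := by
    induction p with
    | nil => rfl
    | cons h _ ih => exact (hstep h).trans ih
  obtain ⟨p⟩ := hconn.preconnected (Sum.inl 0) (Sum.inl x)
  obtain ⟨p, q, h⟩ := AddSubgroup.mem_closure_pair.mp ((hwalk p).mp H.zero_mem)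
  exact ⟨p, q, h.symm⟩

/-- Every connected cubic cyclic Haar graph is hamiltonian. -/
theorem cubic_haarGraph_isHamiltonian (m : ℕ) [NeZero m] (hm : 3 ≤ m)
    (S : Set (ZMod m)) (hS : S.ncard = 3) (h0S : (0 : ZMod m) ∈ S)
    (hconn : (haarGraph m S).Connected) :
    (haarGraph m S).IsHamiltonian := by
  obtain ⟨a, b, hab, hSab⟩ := Set.ncard_eq_two.mp
    (show (S \ {0}).ncard = 2 by rw [Set.ncard_sdiff_singleton_of_mem h0S, hS])
  have ha : a ≠ 0 := (hSab.symm.subset (Set.mem_insert a _)).2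
  have hb : b ≠ 0 := (hSab.symm.subset (Set.mem_insert_of_mem a rfl)).2
  have hc : Function.Injective ![0, a, b] := by
    intro i j h
    fin_cases i <;> fin_cases j <;> simp_all [eq_comm]
  obtain rfl : Set.range ![0, a, b] = S := by
    rw [← Set.insert_sdiff_self_of_mem h0S, hSab]
    simp only [Matrix.range_cons, Matrix.range_empty, Set.union_empty, Set.singleton_union]
  obtain ⟨μ, hμ⟩ :=
    exists_isCohamiltonian ha (exists_eq_zsmul_add_zsmul_of_connected hconn)
  exact hμ.isHamiltonian hc
end

section
/- Let m ≥ 3 be a positive integer and let R, S, T ⊆ ZMod m satisfy R = −R, T = −T, 0 ∉ R ∪ T and 0 ∈ S. Suppose there exist a ∈ R, b ∈ T and c ∈ S with c ≠ 0, 2a ≠ 0, 2b ≠ 0, and gcd(m, a, b, c) = 1 (gcd of m together with the canonical integer representatives of a, b, c). Then the bicirculant B(m;R,S,T) is Hamiltonian. -/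
open SimpleGraph

namespace RoseWindow

open Sum (inl inr)

local notation "π" => QuotientAddGroup.mk

variable {G : Type*} [AddCommGroup G]

section

/-- The path of length two whose inner vertex is the left vertex `h`. -/
def tri (c h : G) : List (G ⊕ G) := [inr h, inl h, inr (h + c)]

/-- `Spans Γ c p q S F`: some path of `Γ` from `p` to `q` has vertex set `S` and contains
the subpath `tri c h` (in either direction) for each `h ∈ F`. -/
def Spans (Γ : SimpleGraph (G ⊕ G)) (c : G) (p q : G ⊕ G) (S : Set (G ⊕ G)) (F : Set G) : Prop :=
  ∃ l : List (G ⊕ G), l.IsChain Γ.Adj ∧ l.Nodup ∧ l.head? = some p ∧ l.getLast? = some q ∧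
    (∀ x, x ∈ l ↔ x ∈ S) ∧ ∀ h ∈ F, tri c h <:+: l ∨ (tri c h).reverse <:+: l

/-- `Closed Γ c S F`: some cycle of `Γ` has vertex set `S` and contains the subpath `tri c h`
for each `h ∈ F`; the subpaths avoid the closing edge. -/
def Closed (Γ : SimpleGraph (G ⊕ G)) (c : G) (S : Set (G ⊕ G)) (F : Set G) : Prop :=
  ∃ p q, Spans Γ c p q S F ∧ Γ.Adj q p

variable {Γ : SimpleGraph (G ⊕ G)} {c : G} {p q p' q' : G ⊕ G} {S S' : Set (G ⊕ G)} {F F' : Set G}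

namespace Spans

theorem single (p : G ⊕ G) : Spans Γ c p p {p} ∅ :=
  ⟨[p], by simp, by simp, by simp, by simp, by simp, by simp⟩

theorem append (h₁ : Spans Γ c p q S F) (h₂ : Spans Γ c p' q' S' F') (hadj : Γ.Adj q p')
    (hd : Disjoint S S') : Spans Γ c p q' (S ∪ S') (F ∪ F') := by
  obtain ⟨l, hc, hn, hh, hl, hS, hF⟩ := h₁
  obtain ⟨l', hc', hn', hh', hl', hS', hF'⟩ := h₂
  refine ⟨l ++ l', ?_, ?_, ?_, ?_, ?_, ?_⟩
  · rw [List.isChain_append]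
    refine ⟨hc, hc', ?_⟩
    intro x hx y hy
    rw [hl] at hx; rw [hh'] at hy
    simp only [Option.mem_def, Option.some.injEq] at hx hy
    subst hx; subst hy; exact hadj
  · rw [List.nodup_append]
    refine ⟨hn, hn', ?_⟩
    rintro x hx y hy rfl
    exact Set.disjoint_left.1 hd ((hS x).1 hx) ((hS' x).1 hy)
  · rw [List.head?_append, hh]; rfl
  · rw [List.getLast?_append, hl']; rfl
  · intro x; simp [hS, hS']
  · rintro h (hh | hh)
    · rcases hF h hh with h1 | h1
      · exact Or.inl (h1.trans (List.prefix_append l l').isInfix)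
      · exact Or.inr (h1.trans (List.prefix_append l l').isInfix)
    · rcases hF' h hh with h1 | h1
      · exact Or.inl (h1.trans (List.suffix_append l l').isInfix)
      · exact Or.inr (h1.trans (List.suffix_append l l').isInfix)

theorem symm (h : Spans Γ c p q S F) : Spans Γ c q p S F := by
  obtain ⟨l, hc, hn, hh, hl, hS, hF⟩ := h
  refine ⟨l.reverse, ?_, by simpa using hn, by simpa using hl, by simpa using hh,
    by simpa using hS, ?_⟩
  · rw [List.isChain_reverse]
    exact hc.imp fun _ _ h => h.symm
  · intro x hx
    rcases hF x hx with h1 | h1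
    · right; exact List.reverse_infix.2 h1
    · left; rw [← List.reverse_infix]; simpa using h1

theorem of (h : Spans Γ c p q S F) (hS : ∀ x, x ∈ S ↔ x ∈ S') (hF : F' ⊆ F) :
    Spans Γ c p q S' F' := by
  obtain ⟨l, hc, hn, hh, hl, hS', hF'⟩ := h
  exact ⟨l, hc, hn, hh, hl, fun x => (hS' x).trans (hS x), fun x hx => hF' x (hF hx)⟩

theorem tri_subset (h : Spans Γ c p q S F) {x : G} (hx : x ∈ F) {y : G ⊕ G} (hy : y ∈ tri c x) :
    y ∈ S := by
  obtain ⟨l, hc, hn, hh, hl, hS, hF⟩ := h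
  rcases hF x hx with h1 | h1
  · exact (hS y).1 (h1.subset hy)
  · exact (hS y).1 (h1.subset (by simpa using hy))

theorem infix_split {α : Type*} {y : α} {I A B : List α} (hI : I <:+: A ++ y :: B)
    (hy : y ∉ I) : I <:+: A ∨ I <:+: B := by
  obtain ⟨s, t, hst⟩ := hI
  rw [List.append_assoc] at hst
  rw [List.append_eq_append_iff] at hst
  rcases hst with ⟨w, hw1, hw2⟩ | ⟨w, hw1, hw2⟩
  · rw [List.append_eq_append_iff] at hw2
    rcases hw2 with ⟨z, hz1, hz2⟩ | ⟨z, hz1, hz2⟩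
    · left; exact ⟨s, z, by rw [hw1, hz1]; simp⟩
    · rcases z with _ | ⟨z0, z⟩
      · left; exact ⟨s, [], by rw [hw1, hz1]; simp⟩
      · exfalso; apply hy
        simp only [List.cons_append, List.cons.injEq] at hz2
        rw [hz1, hz2.1]; simp
  · rcases w with _ | ⟨w0, w⟩
    · rcases I with _ | ⟨i0, I⟩
      · left; exact List.nil_infix
      · exfalso; apply hy
        simp at hw2
        simp [hw2.1]
    · right
      simp at hw2
      exact ⟨w, t, by rw [hw2.2]; simp⟩

theorem splice (h : Spans Γ c p q S F) {t : G} (ht : t ∈ F) :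
    ∃ x z SA SB FA FB, ((x = t ∧ z = t + c) ∨ (x = t + c ∧ z = t)) ∧
      Spans Γ c p (inr x) SA FA ∧ Spans Γ c (inr z) q SB FB ∧ Disjoint SA SB ∧
      inl t ∉ SA ∧ inl t ∉ SB ∧ (∀ y, y ∈ S ↔ y ∈ SA ∨ y ∈ SB ∨ y = inl t) ∧
      F \ {t} ⊆ FA ∪ FB := by
  obtain ⟨l, hc, hn, hh, hl, hS, hF⟩ := h
  have key : ∃ x z A B, ((x = t ∧ z = t + c) ∨ (x = t + c ∧ z = t)) ∧
      l = (A ++ [inr x]) ++ inl t :: (inr z :: B) := by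
    rcases hF t ht with ⟨A, B, h1⟩ | ⟨A, B, h1⟩
    · exact ⟨t, t + c, A, B, Or.inl ⟨rfl, rfl⟩, by rw [← h1]; simp [tri]⟩
    · exact ⟨t + c, t, A, B, Or.inr ⟨rfl, rfl⟩, by rw [← h1]; simp [tri]⟩
  obtain ⟨x, z, A, B, hxz, rfl⟩ := key
  have hmem : ∀ y, y ∈ S ↔ y ∈ {y | y ∈ A ++ [inr x]} ∨ y ∈ {y | y ∈ inr z :: B} ∨ y = inl t := by
    intro y
    rw [← hS]
    simp only [List.mem_append, List.mem_cons, Set.mem_ofPred_eq]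
    tauto
  rw [List.nodup_append] at hn
  obtain ⟨hnA, hnB, hnd⟩ := hn
  rw [List.nodup_cons] at hnB
  rw [List.isChain_append] at hc
  refine ⟨x, z, {y | y ∈ A ++ [inr x]}, {y | y ∈ inr z :: B},
    {h | tri c h <:+: A ++ [inr x] ∨ (tri c h).reverse <:+: A ++ [inr x]},
    {h | tri c h <:+: inr z :: B ∨ (tri c h).reverse <:+: inr z :: B}, hxz, ?_, ?_, ?_, ?_, ?_,
    hmem, ?_⟩
  · refine ⟨A ++ [inr x], hc.1, hnA, ?_, by simp, fun _ => Iff.rfl, fun _ h => h⟩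
    rw [List.head?_append] at hh
    cases A <;> simpa using hh
  · refine ⟨inr z :: B, hc.2.1.tail, hnB.2, by simp, ?_, fun _ => Iff.rfl, fun _ h => h⟩
    rw [List.getLast?_append, List.getLast?_cons_cons] at hl
    simpa [List.getLast?_cons] using hl
  · rw [Set.disjoint_left]
    intro y h1 h2
    exact hnd y h1 y (List.mem_cons_of_mem _ h2) rfl
  · intro h1
    exact hnd _ h1 _ List.mem_cons_self rfl
  · exact hnB.1
  · rintro h ⟨h1, h2⟩
    have hne : inl t ∉ tri c h := by
      simp only [tri, List.mem_cons, reduceCtorEq, Sum.inl.injEq, List.not_mem_nil, or_false,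
        false_or]
      exact fun h => h2 h.symm
    rcases hF h h1 with h1 | h1
    · rcases infix_split h1 hne with h1 | h1
      · left; left; exact h1
      · right; left; exact h1
    · rcases infix_split h1 (by simpa using hne) with h1 | h1
      · left; right; exact h1
      · right; right; exact h1

end Spans

theorem Closed.of (h : Closed Γ c S F) (hS : ∀ x, x ∈ S ↔ x ∈ S') (hF : F' ⊆ F) :
    Closed Γ c S' F' := by
  obtain ⟨p, q, h, hadj⟩ := h
  exact ⟨p, q, h.of hS hF, hadj⟩

theorem Closed.isHamiltonian [Fintype G] [DecidableEq G] (h : Closed Γ c Set.univ F)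
    (hcard : 3 ≤ Fintype.card (G ⊕ G)) : Γ.IsHamiltonian := by
  obtain ⟨p, q, ⟨l, hc, hn, hh, hl, hS, -⟩, hadj⟩ := h
  intro _
  have hne : l ≠ [] := by rintro rfl; simp at hh
  have hp : l.head hne = p := by
    rw [List.head?_eq_some_head hne] at hh; simpa using hh
  have hq : l.getLast hne = q := by
    rw [List.getLast?_eq_some_getLast hne] at hl; simpa using hl
  let w : Γ.Walk p q := (Walk.ofSupport l hne hc).copy hp hq
  have hw : w.support = l := by simp [w]
  have hlen : l.length = Fintype.card (G ⊕ G) := by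
    rw [← List.toFinset_card_of_nodup hn, ← Finset.card_univ]
    congr 1
    ext x; simp [hS]
  have hpath : w.IsPath := by rw [Walk.isPath_def, hw]; exact hn
  have hwl : w.length + 1 = l.length := by rw [← hw, Walk.length_support]
  refine ⟨q, Walk.cons hadj w, ?_⟩
  rw [Walk.isHamiltonianCycle_iff_isCycle_and_length_eq]
  constructor
  · rw [Walk.cons_isCycle_iff]
    refine ⟨hpath, ?_⟩
    intro he
    have h2 := hpath.length_eq_one_of_mem_edges (by rwa [Sym2.eq_swap] at he)
    omega
  · rw [Walk.length_cons]; omega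

end

/-- The edges of a generalized rose window graph with parameters `a`, `b`, `c`. -/
structure IsRose (Γ : SimpleGraph (G ⊕ G)) (a b c : G) : Prop where intro ::
  left : ∀ g, Γ.Adj (inl g) (inl (g + a))
  right : ∀ g, Γ.Adj (inr g) (inr (g + b))
  spoke : ∀ g, Γ.Adj (inl g) (inr g)
  spoke_add : ∀ g, Γ.Adj (inl g) (inr (g + c))

/-- The vertices whose index lies in one of the cosets of `⟨c⟩` collected in `W`. -/
def cells (c : G) (W : Set (G ⧸ AddSubgroup.zmultiples c)) : Set (G ⊕ G) :=
  {x | (QuotientAddGroup.mk (x.elim id id) : G ⧸ AddSubgroup.zmultiples c) ∈ W}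

/-- The vertices whose index lies in the coset `g + ⟨c⟩`. -/
abbrev cell (c g : G) : Set (G ⊕ G) := cells c {QuotientAddGroup.mk g}

section

variable {c g : G} {W : Set (G ⧸ AddSubgroup.zmultiples c)}

@[simp] theorem inl_mem_cells : (inl g : G ⊕ G) ∈ cells c W ↔ QuotientAddGroup.mk g ∈ W := Iff.rfl

@[simp] theorem inr_mem_cells : (inr g : G ⊕ G) ∈ cells c W ↔ QuotientAddGroup.mk g ∈ W := Iff.rfl

theorem disjoint_cells {W W' : Set (G ⧸ AddSubgroup.zmultiples c)} (h : Disjoint W W') :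
    Disjoint (cells c W) (cells c W') := by
  rw [Set.disjoint_left] at h ⊢
  exact fun x => @h _

@[simp] theorem mk_c : (QuotientAddGroup.mk c : G ⧸ AddSubgroup.zmultiples c) = 0 := by
  rw [QuotientAddGroup.eq_zero_iff]; exact AddSubgroup.mem_zmultiples c

@[simp] theorem mk_add_c (x : G) :
    (QuotientAddGroup.mk (x + c) : G ⧸ AddSubgroup.zmultiples c) = QuotientAddGroup.mk x := by
  rw [QuotientAddGroup.mk_add, mk_c, add_zero]

theorem mk_zsmul_c (i : ℤ) :
    (QuotientAddGroup.mk (i • c) : G ⧸ AddSubgroup.zmultiples c) = 0 := by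
  rw [QuotientAddGroup.mk_zsmul, mk_c, smul_zero]

theorem mk_eq_mk_iff {x y : G} :
    (QuotientAddGroup.mk x : G ⧸ AddSubgroup.zmultiples c) = QuotientAddGroup.mk y ↔
      ∃ i : ℤ, y = x + i • c := by
  rw [QuotientAddGroup.eq, AddSubgroup.mem_zmultiples_iff]
  constructor
  · rintro ⟨i, hi⟩; exact ⟨i, by rw [hi]; abel⟩
  · rintro ⟨i, rfl⟩; exact ⟨i, by abel⟩

/-- The closed walk through the vertices of `cell c g` along the spokes. -/
def zig (c g : G) (n : ℤ) : G ⊕ G :=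
  if Even n then inl (g + (n / 2) • c) else inr (g + ((n + 1) / 2) • c)

theorem zig_even (c g : G) (i : ℤ) : zig c g (2 * i) = inl (g + i • c) := by
  simp [zig]

theorem zig_odd (c g : G) (i : ℤ) : zig c g (2 * i - 1) = inr (g + i • c) := by
  have : ¬ Even (2 * i - 1) := by
    rw [Int.not_even_iff_odd]; exact ⟨i - 1, by ring⟩
  rw [zig, if_neg this]; congr; omega

theorem zig_mem_cell (n : ℤ) : zig c g n ∈ cell c g := by
  rcases Int.even_or_odd' n with ⟨i, rfl | rfl⟩
  · simp [zig_even]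
  · rw [show 2 * i + 1 = 2 * (i + 1) - 1 by ring, zig_odd]
    simp

theorem zig_inj [Finite G] {n m : ℤ} (h : zig c g n = zig c g m) :
    (2 * addOrderOf c : ℤ) ∣ n - m := by
  rcases Int.even_or_odd' n with ⟨i, rfl | rfl⟩ <;> rcases Int.even_or_odd' m with ⟨j, rfl | rfl⟩
  · simp only [zig_even, Sum.inl.injEq, add_right_inj] at h
    rw [← sub_eq_zero, ← sub_smul, ← addOrderOf_dvd_iff_zsmul_eq_zero] at h
    rw [← mul_sub]; exact mul_dvd_mul_left 2 h
  · rw [zig_even, show 2 * j + 1 = 2 * (j + 1) - 1 by ring, zig_odd] at h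
    cases h
  · rw [zig_even, show 2 * i + 1 = 2 * (i + 1) - 1 by ring, zig_odd] at h
    cases h
  · simp only [show ∀ i : ℤ, 2 * i + 1 = 2 * (i + 1) - 1 by intro i; ring, zig_odd, Sum.inr.injEq,
      add_right_inj] at h
    rw [← sub_eq_zero, ← sub_smul, ← addOrderOf_dvd_iff_zsmul_eq_zero] at h
    rw [show 2 * i + 1 - (2 * j + 1) = 2 * (i + 1 - (j + 1)) by ring]; exact mul_dvd_mul_left 2 h

theorem zig_add_mul (n i : ℤ) : zig c g (n + 2 * i) = zig c (g + i • c) n := by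
  rcases Int.even_or_odd' n with ⟨j, rfl | rfl⟩
  · rw [← mul_add, zig_even, zig_even, add_smul]; congr 1; abel
  · rw [show 2 * j + 1 + 2 * i = 2 * (j + 1 + i) - 1 by ring,
      show 2 * j + 1 = 2 * (j + 1) - 1 by ring, zig_odd, zig_odd, add_smul (j + 1)]; congr 1; abel

theorem zig_add_period (n i : ℤ) : zig c g (n + 2 * addOrderOf c * i) = zig c g n := by
  rw [mul_assoc, zig_add_mul, mul_comm, mul_smul, natCast_zsmul, addOrderOf_nsmul_eq_zero,
    smul_zero, add_zero]

theorem mem_cell_iff [Finite G] (i : ℤ) {x : G ⊕ G} :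
    x ∈ cell c g ↔ ∃ n, i ≤ n ∧ n < i + 2 * addOrderOf c ∧ zig c g n = x := by
  have hk : 0 < addOrderOf c := addOrderOf_pos c
  constructor
  · intro hx
    have : ∃ m, zig c g m = x := by
      rcases x with x | x
      · obtain ⟨j, hj⟩ := mk_eq_mk_iff.1 ((Set.mem_singleton_iff.1 (inl_mem_cells.1 hx)).symm)
        exact ⟨2 * j, by rw [zig_even, hj]⟩
      · obtain ⟨j, hj⟩ := mk_eq_mk_iff.1 ((Set.mem_singleton_iff.1 (inr_mem_cells.1 hx)).symm)
        exact ⟨2 * j - 1, by rw [zig_odd, hj]⟩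
    obtain ⟨m, rfl⟩ := this
    have hK : (0 : ℤ) < 2 * addOrderOf c := by omega
    refine ⟨i + (m - i) % (2 * addOrderOf c), ?_, ?_, ?_⟩
    · have := Int.emod_nonneg (m - i) hK.ne'; omega
    · have := Int.emod_lt_of_pos (m - i) hK; omega
    · rw [← zig_add_period _ ((m - i) / (2 * addOrderOf c)), add_assoc, Int.emod_add_mul_ediv]
      congr 1; ring
  · rintro ⟨n, -, -, rfl⟩; exact zig_mem_cell n

/-- The vertices `zig c g n` with `i ≤ n ≤ j`. -/
def arc (c g : G) (i j : ℤ) : Set (G ⊕ G) := {x | ∃ n, i ≤ n ∧ n ≤ j ∧ zig c g n = x}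

theorem arc_subset_cell {i j : ℤ} : arc c g i j ⊆ cell c g := by
  rintro _ ⟨n, -, -, rfl⟩; exact zig_mem_cell n

/-- Membership in an arc is decided inside any window of one period. -/
theorem zig_mem_arc_iff [Finite G] {i j n w : ℤ} (hi : w ≤ i) (hj : j < w + 2 * addOrderOf c)
    (hn : w ≤ n) (hn' : n < w + 2 * addOrderOf c) :
    zig c g n ∈ arc c g i j ↔ i ≤ n ∧ n ≤ j := by
  constructor
  · rintro ⟨m, h1, h2, h3⟩
    have h4 := Int.eq_zero_of_abs_lt_dvd (zig_inj h3) (by rw [abs_lt]; constructor <;> omega)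
    obtain rfl : m = n := by omega
    exact ⟨h1, h2⟩
  · rintro ⟨h1, h2⟩; exact ⟨n, h1, h2, rfl⟩

theorem zig_eq_iff [Finite G] {n m w : ℤ} (hm : w ≤ m) (hm' : m < w + 2 * addOrderOf c)
    (hn : w ≤ n) (hn' : n < w + 2 * addOrderOf c) :
    zig c g n = zig c g m ↔ n = m := by
  constructor
  · intro h3
    have h4 := Int.eq_zero_of_abs_lt_dvd (zig_inj h3) (by rw [abs_lt]; constructor <;> omega)
    omega
  · rintro rfl; rfl

end

namespace IsRose

variable {Γ : SimpleGraph (G ⊕ G)} {a b c : G}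

theorem adj_zig (hΓ : IsRose Γ a b c) (g : G) (n : ℤ) : Γ.Adj (zig c g n) (zig c g (n + 1)) := by
  rcases Int.even_or_odd' n with ⟨i, rfl | rfl⟩
  · rw [show 2 * i + 1 = 2 * (i + 1) - 1 by ring, zig_odd, zig_even, add_smul, one_smul,
      ← add_assoc]
    exact hΓ.spoke_add _
  · rw [show 2 * i + 1 + 1 = 2 * (i + 1) by ring, show 2 * i + 1 = 2 * (i + 1) - 1 by ring, zig_odd,
      zig_even]
    exact (hΓ.spoke _).symm

theorem arc [Finite G] (hΓ : IsRose Γ a b c) (g : G) {i j : ℤ} (hij : i ≤ j)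
    (hj : j < i + 2 * addOrderOf c) :
    Spans Γ c (zig c g i) (zig c g j) (arc c g i j)
      {h | ∃ n : ℤ, i < 2 * n ∧ 2 * n < j ∧ h = g + n • c} := by
  obtain ⟨N, rfl⟩ : ∃ N : ℕ, j = i + N := ⟨(j - i).toNat, by omega⟩
  refine ⟨(List.range' 0 (N + 1)).map fun t : ℕ => zig c g (i + t), ?_, ?_, ?_, ?_, ?_, ?_⟩
  · rw [List.isChain_map]
    refine (List.isChain_range' 0 (N + 1) 1).imp ?_
    rintro x y rfl
    have := hΓ.adj_zig g (i + x)
    push_cast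
    rwa [← add_assoc]
  · refine List.Nodup.map_on ?_ List.nodup_range'
    intro x hx y hy hxy
    simp only [List.mem_range'_1] at hx hy
    have := (zig_eq_iff (w := i) (by omega) (by omega) (by omega) (by omega)).1 hxy
    omega
  · simp [List.range'_succ]
  · simp [List.getLast?_range']
  · intro x
    simp only [List.mem_map, List.mem_range'_1]
    constructor
    · rintro ⟨t, ht, rfl⟩; exact ⟨i + t, by omega, by omega, rfl⟩
    · rintro ⟨n, h1, h2, rfl⟩
      exact ⟨(n - i).toNat, by omega, by congr 1; omega⟩
  · rintro _ ⟨n, h1, h2, rfl⟩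
    left
    obtain ⟨s, hs⟩ : ∃ s : ℕ, i + s = 2 * n - 1 := ⟨(2 * n - 1 - i).toNat, by omega⟩
    obtain ⟨r, rfl⟩ : ∃ r : ℕ, N = s + 2 + r := ⟨N - s - 2, by omega⟩
    refine ⟨(List.range' 0 s).map fun t : ℕ => zig c g (i + t),
      (List.range' (s + 3) r).map fun t : ℕ => zig c g (i + t), ?_⟩
    have e1 : List.range' 0 (s + 2 + r + 1) = List.range' 0 s ++ List.range' s 3 ++
        List.range' (s + 3) r := by
      have h1 := List.range'_append_1 (s := 0) (m := s) (n := 3)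
      have h2 := List.range'_append_1 (s := 0) (m := s + 3) (n := r)
      rw [zero_add] at h1 h2
      rw [h1, h2]; congr 1; omega
    rw [e1]
    simp only [List.map_append]
    congr 2
    simp only [List.range', List.map_cons, List.map_nil, tri]
    push_cast
    rw [show i + ((s : ℤ) + 1 + 1) = 2 * (n + 1) - 1 by omega,
      show i + ((s : ℤ) + 1) = 2 * n by omega, hs, zig_odd, zig_odd, zig_even, add_smul, one_smul,
      add_assoc]

end IsRose

theorem two_le_addOrderOf [Finite G] {c : G} (hc : c ≠ 0) : 2 ≤ addOrderOf c := by
  have h1 := addOrderOf_pos c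
  have h2 : addOrderOf c ≠ 1 := by rwa [Ne, AddMonoid.addOrderOf_eq_one_iff]
  omega

theorem zig_zero (c g : G) : zig c g 0 = inl g := by simpa using zig_even c g 0

theorem zig_one (c g : G) : zig c g 1 = inr (g + c) := by simpa using zig_odd c g 1

theorem zig_two (c g : G) : zig c g 2 = inl (g + c) := by simpa using zig_even c g 1

theorem zig_period (c g : G) : zig c g (2 * addOrderOf c) = inl g := by
  rw [zig_even, natCast_zsmul, addOrderOf_nsmul_eq_zero, add_zero]

theorem zig_period_sub_one (c g : G) : zig c g (2 * addOrderOf c - 1) = inr g := by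
  rw [zig_odd, natCast_zsmul, addOrderOf_nsmul_eq_zero, add_zero]

namespace IsRose

variable [Finite G] {Γ : SimpleGraph (G ⊕ G)} {a b c : G}

theorem full (hΓ : IsRose Γ a b c) (hc : c ≠ 0) (g : G) {s : G} (hs : s = 0 ∨ s = c) :
    Spans Γ c (inl g) (inr (g + s)) (cell c g) {g + c} := by
  have hk := two_le_addOrderOf hc
  rcases hs with rfl | rfl
  · have h := hΓ.arc g (i := 0) (j := 2 * addOrderOf c - 1) (by omega) (by omega)
    rw [zig_zero, zig_period_sub_one] at h
    rw [add_zero]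
    refine h.of (fun x => ?_) ?_
    · rw [mem_cell_iff 0]
      constructor
      · rintro ⟨n, h1, h2, h3⟩; exact ⟨n, h1, by omega, h3⟩
      · rintro ⟨n, h1, h2, h3⟩; exact ⟨n, h1, by omega, h3⟩
    · rintro _ rfl; exact ⟨1, by omega, by omega, by simp⟩
  · have h := hΓ.arc g (i := 1) (j := 2 * addOrderOf s) (by omega) (by omega)
    rw [zig_one, zig_period] at h
    refine h.symm.of (fun x => ?_) ?_
    · rw [mem_cell_iff 1]
      constructor
      · rintro ⟨n, h1, h2, h3⟩; exact ⟨n, h1, by omega, h3⟩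
      · rintro ⟨n, h1, h2, h3⟩; exact ⟨n, h1, by omega, h3⟩
    · rintro _ rfl; exact ⟨1, by omega, by omega, by simp⟩

theorem rem (hΓ : IsRose Γ a b c) (hc : c ≠ 0) (g : G) :
    Spans Γ c (inr (g + c)) (inr g) (cell c g \ {inl g}) {g + c} := by
  have hk := two_le_addOrderOf hc
  have h := hΓ.arc g (i := 1) (j := 2 * addOrderOf c - 1) (by omega) (by omega)
  rw [zig_one, zig_period_sub_one] at h
  refine h.of (fun x => ?_) ?_
  · rw [Set.mem_sdiff, mem_cell_iff 0, Set.mem_singleton_iff]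
    constructor
    · rintro ⟨n, h1, h2, rfl⟩
      refine ⟨⟨n, by omega, by omega, rfl⟩, ?_⟩
      rw [← zig_zero c, zig_eq_iff (w := 0)] <;> omega
    · rintro ⟨⟨n, h1, h2, rfl⟩, h3⟩
      rw [← zig_zero c, zig_eq_iff (w := 0)] at h3 <;> try omega
      exact ⟨n, by omega, by omega, rfl⟩
  · rintro _ rfl; exact ⟨1, by omega, by omega, by simp⟩

theorem rem_two (hΓ : IsRose Γ a b c) (hc : c ≠ 0) (g : G) :
    Spans Γ c (inl (g + c)) (inr g) (cell c g \ {inl g, inr (g + c)}) ∅ := by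
  have hk := two_le_addOrderOf hc
  have h := hΓ.arc g (i := 2) (j := 2 * addOrderOf c - 1) (by omega) (by omega)
  rw [zig_two, zig_period_sub_one] at h
  refine h.of (fun x => ?_) (by simp)
  rw [Set.mem_sdiff, mem_cell_iff 0, Set.mem_insert_iff, Set.mem_singleton_iff, ← zig_zero c g,
    ← zig_one c g]
  constructor
  · rintro ⟨n, h1, h2, rfl⟩
    refine ⟨⟨n, by omega, by omega, rfl⟩, ?_⟩
    rw [zig_eq_iff (w := 0), zig_eq_iff (w := 0)] <;> omega
  · rintro ⟨⟨n, h1, h2, rfl⟩, h3⟩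
    rw [zig_eq_iff (w := 0), zig_eq_iff (w := 0)] at h3 <;> try omega
    exact ⟨n, by omega, by omega, rfl⟩

end IsRose

theorem self_mem_cell (c g : G) : (inl g : G ⊕ G) ∈ cell c g := by simp

theorem IsRose.spoke_of {Γ : SimpleGraph (G ⊕ G)} {a b c : G} (hΓ : IsRose Γ a b c)
    {t x z : G} (h : (x = t ∧ z = t + c) ∨ (x = t + c ∧ z = t)) :
    Γ.Adj (inl t) (inr x) ∧ Γ.Adj (inl t) (inr z) := by
  rcases h with ⟨rfl, rfl⟩ | ⟨rfl, rfl⟩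
  · exact ⟨hΓ.spoke _, hΓ.spoke_add _⟩
  · exact ⟨hΓ.spoke_add _, hΓ.spoke _⟩

namespace IsRose

variable [Finite G] {Γ : SimpleGraph (G ⊕ G)} {a b c : G} {S : Set (G ⊕ G)} {F : Set G}

theorem splice_open (hΓ : IsRose Γ a b c) (hc : c ≠ 0) (h : Closed Γ c S F) {t : G} (ht : t ∈ F)
    (hd : Disjoint S (cell c (t + b))) :
    Spans Γ c (inl t) (inl (t + b)) (S ∪ cell c (t + b)) ((F \ {t}) ∪ {t + b + c}) := by
  obtain ⟨p, q, h, hadj⟩ := h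
  obtain ⟨x, z, SA, SB, FA, FB, hxz, hA, hB, hAB, hAt, hBt, hS, hF⟩ := h.splice ht
  obtain ⟨h1, h2⟩ := hΓ.spoke_of hxz
  have hfull : Spans Γ c (inl (t + b)) (inr (x + b)) (cell c (t + b)) {t + b + c} := by
    rcases hxz with ⟨rfl, rfl⟩ | ⟨rfl, rfl⟩
    · simpa using hΓ.full hc (x + b) (Or.inl rfl)
    · simpa [add_right_comm] using hΓ.full hc (z + b) (Or.inr rfl)
  rw [Set.disjoint_left] at hAB hd
  refine ((Spans.single (inl t)).append ((hB.append hA hadj ?_).append hfull.symm (hΓ.right x) ?_)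
    h2 ?_).of ?_ ?_
  all_goals (try rw [Set.disjoint_left])
  all_goals grind

theorem splice_step (hΓ : IsRose Γ a b c) (hc : c ≠ 0) {g h t : G}
    (hP : Spans Γ c (inl g) (inl h) S F) (ht : t ∈ F) (hg : t = g + a) (hh : t + b = h + a)
    (hd : Disjoint S (cell c (t + b))) :
    Spans Γ c (inl t) (inl (t + b)) (S ∪ cell c (t + b)) ((F \ {t}) ∪ {t + b + c}) := by
  obtain ⟨x, z, SA, SB, FA, FB, hxz, hA, hB, hAB, hAt, hBt, hS, hF⟩ := hP.splice ht
  have hrem : Spans Γ c (inr (x + b)) (inr (z + b)) (cell c (t + b) \ {inl (t + b)})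
      {t + b + c} := by
    rcases hxz with ⟨rfl, rfl⟩ | ⟨rfl, rfl⟩
    · simpa [add_right_comm] using (hΓ.rem hc (x + b)).symm
    · simpa [add_right_comm] using hΓ.rem hc (z + b)
  have hself := self_mem_cell c (t + b)
  rw [Set.disjoint_left] at hAB hd
  have h1 : Γ.Adj (inl t) (inl g) := by rw [hg]; exact (hΓ.left g).symm
  have h2 : Γ.Adj (inl h) (inl (t + b)) := by rw [hh]; exact hΓ.left h
  refine ((Spans.single (inl t)).append ((hA.append (hrem.append (hB.append
    (Spans.single (inl (t + b))) h2 ?_) (hΓ.right z).symm ?_) (hΓ.right x) ?_)) h1 ?_).of ?_ ?_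
  all_goals (try rw [Set.disjoint_left])
  all_goals grind

theorem splice_close (hΓ : IsRose Γ a b c) (hc : c ≠ 0) {g h t : G}
    (hP : Spans Γ c (inl g) (inl h) S F) (ht : t ∈ F) (hg : t = g + a) (hh : t + b = h + a)
    (hd : Disjoint S (cell c (t + b))) :
    Closed Γ c (S ∪ cell c (t + b)) ((F \ {t}) ∪ {t + b + c}) := by
  obtain ⟨x, z, SA, SB, FA, FB, hxz, hA, hB, hAB, hAt, hBt, hS, hF⟩ := hP.splice ht
  obtain ⟨h1, h2⟩ := hΓ.spoke_of hxz
  have hfull : Spans Γ c (inl (t + b)) (inr (x + b)) (cell c (t + b)) {t + b + c} := by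
    rcases hxz with ⟨rfl, rfl⟩ | ⟨rfl, rfl⟩
    · simpa using hΓ.full hc (x + b) (Or.inl rfl)
    · simpa [add_right_comm] using hΓ.full hc (z + b) (Or.inr rfl)
  rw [Set.disjoint_left] at hAB hd
  have h3 : Γ.Adj (inl g) (inl t) := by rw [hg]; exact hΓ.left g
  have h4 : Γ.Adj (inl h) (inl (t + b)) := by rw [hh]; exact hΓ.left h
  refine ⟨_, _, ((Spans.single (inl t)).append ((hB.append hfull h4 ?_).append hA.symm
    (hΓ.right x).symm ?_) h2 ?_).of ?_ ?_, h3⟩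
  all_goals (try rw [Set.disjoint_left])
  all_goals grind

end IsRose

namespace IsRose

variable [Finite G] {Γ : SimpleGraph (G ⊕ G)} {a b c : G} {S : Set (G ⊕ G)} {F : Set G}

/-- A cycle through the fresh vertices `q, q + a, …, q + (n - 1) • a` can be extended by the cells
of their `b`-translates. -/
theorem run_add (hΓ : IsRose Γ a b c) (hc : c ≠ 0) {W : Set (G ⧸ AddSubgroup.zmultiples c)}
    (h : Closed Γ c (cells c W) F) {q : G} {n : ℕ} (hn : 2 ≤ n) (hF : ∀ j < n, q + j • a ∈ F)
    (hinj : ∀ i < n, ∀ j < n, (π (q + b + i • a) : G ⧸ AddSubgroup.zmultiples c) =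
      π (q + b + j • a) → i = j)
    (hW : ∀ j < n, (π (q + b + j • a) : G ⧸ AddSubgroup.zmultiples c) ∉ W) :
    Closed Γ c (cells c (W ∪ {x | ∃ j < n, x = π (q + b + j • a)}))
      {y | ∃ j < n, y = q + b + c + j • a} := by
  have hd : ∀ j < n, Disjoint (cells c (W ∪ {x | ∃ i < j, x = π (q + b + i • a)}))
      (cell c (q + j • a + b)) := by
    intro j hj
    apply disjoint_cells
    rw [Set.disjoint_singleton_right]
    rintro (h1 | ⟨i, hi, h1⟩)
    · exact hW j hj (by rwa [add_right_comm] at h1)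
    · rw [add_right_comm] at h1
      have := hinj _ hj _ (by omega) h1
      omega
  have hset : ∀ j, ∀ x : G ⊕ G, (x ∈ cells c (W ∪ {x | ∃ i < j, x = π (q + b + i • a)}) ∪
      cell c (q + j • a + b)) ↔ x ∈ cells c (W ∪ {x | ∃ i < j + 1, x = π (q + b + i • a)}) := by
    intro j x
    have : ∀ y : G ⧸ AddSubgroup.zmultiples c, (y ∈ W ∪ {x | ∃ i < j, x = π (q + b + i • a)} ∨
        y = π (q + j • a + b)) ↔ y ∈ W ∪ {x | ∃ i < j + 1, x = π (q + b + i • a)} := by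
      intro y
      rw [add_right_comm]
      simp only [Set.mem_union, Set.mem_ofPred_eq, Order.lt_add_one_iff, Nat.le_iff_lt_or_eq,
        or_and_right, exists_or, exists_eq_left, or_assoc]
    exact this _
  have hFstep : ∀ j < n, {y | (∃ i < n, j ≤ i ∧ y = q + i • a) ∨ ∃ i < j, y = q + b + c + i • a} \
      {q + j • a} ∪ {q + j • a + b + c} ⊇ {y | (∃ i < n, j + 1 ≤ i ∧ y = q + i • a) ∨
        ∃ i < j + 1, y = q + b + c + i • a} := by
    rintro j hj y (⟨i, hi, hij, rfl⟩ | ⟨i, hi, rfl⟩)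
    · left
      refine ⟨Or.inl ⟨i, hi, by omega, rfl⟩, ?_⟩
      intro h1
      have := hinj i hi j hj (by rw [add_right_comm, h1, add_right_comm])
      omega
    · rcases Nat.lt_or_ge i j with h1 | h1
      · left
        refine ⟨Or.inr ⟨i, h1, rfl⟩, ?_⟩
        intro h2
        have h3 := h.choose_spec.choose_spec.1.tri_subset (hF j hj) (y := inl (q + j • a))
          (by simp [tri])
        rw [← h2, inl_mem_cells, add_right_comm, mk_add_c] at h3
        exact hW i (by omega) h3
      · obtain rfl : i = j := by omega
        right
        rw [Set.mem_singleton_iff]; abel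
  have key : ∀ j, j + 1 < n → Spans Γ c (inl (q + j • a)) (inl (q + j • a + b))
      (cells c (W ∪ {x | ∃ i < j + 1, x = π (q + b + i • a)}))
      {y | (∃ i < n, j + 1 ≤ i ∧ y = q + i • a) ∨ ∃ i < j + 1, y = q + b + c + i • a} := by
    intro j
    induction j with
    | zero =>
      intro hj
      have h0 : Closed Γ c (cells c (W ∪ {x | ∃ i < 0, x = π (q + b + i • a)}))
          {y | (∃ i < n, 0 ≤ i ∧ y = q + i • a) ∨ ∃ i < 0, y = q + b + c + i • a} := by
        refine h.of (by simp) ?_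
        rintro y (⟨i, hi, -, rfl⟩ | ⟨i, hi, rfl⟩)
        · exact hF i hi
        · omega
      exact (hΓ.splice_open hc h0 (t := q + 0 • a) (Or.inl ⟨0, by omega, le_rfl, rfl⟩)
        (hd 0 (by omega))).of (hset 0) (hFstep 0 (by omega))
    | succ j ih =>
      intro hj
      exact (hΓ.splice_step hc (ih (by omega)) (t := q + (j + 1) • a)
        (Or.inl ⟨j + 1, by omega, le_rfl, rfl⟩) (by rw [succ_nsmul]; abel)
        (by rw [succ_nsmul]; abel) (hd (j + 1) (by omega))).of (hset (j + 1))
        (hFstep (j + 1) (by omega))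
  obtain ⟨j, rfl⟩ : ∃ j, n = j + 2 := ⟨n - 2, by omega⟩
  refine (hΓ.splice_close hc (key j (by omega)) (t := q + (j + 1) • a)
    (Or.inl ⟨j + 1, by omega, le_rfl, rfl⟩) (by rw [succ_nsmul]; abel)
    (by rw [succ_nsmul]; abel) (hd (j + 1) (by omega))).of (hset (j + 1)) ?_
  refine Set.Subset.trans ?_ (hFstep (j + 1) (by omega))
  intro y hy
  exact Or.inr hy

end IsRose

section

theorem exists_zsmul_eq [Finite G] (c : G) (w j : ℤ) :
    ∃ i : ℤ, w ≤ i ∧ i < w + addOrderOf c ∧ i • c = j • c := by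
  have hk : (0 : ℤ) < addOrderOf c := by exact_mod_cast addOrderOf_pos c
  refine ⟨w + (j - w) % addOrderOf c, ?_, ?_, ?_⟩
  · have := Int.emod_nonneg (j - w) hk.ne'; omega
  · have := Int.emod_lt_of_pos (j - w) hk; omega
  · rw [← sub_eq_zero, ← sub_smul, ← addOrderOf_dvd_iff_zsmul_eq_zero]
    have := Int.emod_add_mul_ediv (j - w) (addOrderOf c)
    exact ⟨-((j - w) / addOrderOf c), by linear_combination this⟩

variable {Γ : SimpleGraph (G ⊕ G)} {a b c x g : G} {W : Set (G ⧸ AddSubgroup.zmultiples c)}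
  {F : Set G} {y y' : G ⊕ G}

/-- Two disjoint paths covering `cells c W`, one from `inl x` to `y` and one from `y'` to
`inl (g + b)`, where `x ∈ {g, g + c}`. -/
def Strip (Γ : SimpleGraph (G ⊕ G)) (b c x g : G) (W : Set (G ⧸ AddSubgroup.zmultiples c))
    (y y' : G ⊕ G) (F : Set G) : Prop :=
  ∃ S₁ S₂ F₁ F₂, (x = g ∨ x = g + c) ∧ Spans Γ c (inl x) y S₁ F₁ ∧
    Spans Γ c y' (inl (g + b)) S₂ F₂ ∧ Disjoint S₁ S₂ ∧
    (∀ z, z ∈ cells c W ↔ z ∈ S₁ ∨ z ∈ S₂) ∧ F ⊆ F₁ ∪ F₂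

namespace IsRose

variable [Finite G]

theorem strip_base (hΓ : IsRose Γ a b c) (hc : c ≠ 0) (g : G) {h : G}
    (hh : (π h : G ⧸ AddSubgroup.zmultiples c) = π (g + b))
    (hb : (π g : G ⧸ AddSubgroup.zmultiples c) ≠ π (g + b)) :
    Strip Γ b c g g {π g, π (g + b)} (inr h) (inl h) {z | h = g + b ∧ z = g + b + c} := by
  have hk := two_le_addOrderOf hc
  obtain ⟨j, hj⟩ := mk_eq_mk_iff.1 hh.symm
  obtain ⟨i, hi1, hi2, hi⟩ := exists_zsmul_eq c 1 j
  rw [← hi] at hj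
  have h1 := hΓ.arc (g + b) (i := 1) (j := 2 * i - 1) (by omega) (by omega)
  have h2 := hΓ.arc (g + b) (i := 2 * i) (j := 2 * addOrderOf c) (by omega) (by omega)
  rw [zig_one, zig_odd, ← hj] at h1
  rw [zig_even, zig_period, ← hj] at h2
  have h0 := hΓ.full hc g (Or.inr rfl)
  have hadj := hΓ.right (g + c)
  rw [add_right_comm] at hadj
  have hdc : Disjoint (cell c g) (cell c (g + b)) := disjoint_cells (by simpa using hb)
  have harc : Disjoint (RoseWindow.arc c (g + b) 1 (2 * i - 1))
      (RoseWindow.arc c (g + b) (2 * i) (2 * addOrderOf c)) := by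
    rw [Set.disjoint_left]
    rintro _ ⟨n, hn1, hn2, rfl⟩ hn3
    rw [zig_mem_arc_iff (w := 1)] at hn3 <;> omega
  have harc' : ∀ z, z ∈ cell c (g + b) ↔ z ∈ RoseWindow.arc c (g + b) 1 (2 * i - 1) ∨
      z ∈ RoseWindow.arc c (g + b) (2 * i) (2 * addOrderOf c) := by
    intro z
    constructor
    · rw [mem_cell_iff 1]
      rintro ⟨n, hn1, hn2, rfl⟩
      rw [zig_mem_arc_iff (w := 1), zig_mem_arc_iff (w := 1)] <;> omega
    · rintro (hz | hz) <;> exact arc_subset_cell hz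
  refine ⟨_, _, _, _, Or.inl rfl, h0.append h1 hadj (hdc.mono_right arc_subset_cell), h2,
    ?_, ?_, ?_⟩
  · rw [Set.disjoint_left] at *
    have := @harc'
    grind
  · intro z
    rw [Set.mem_union, or_assoc, ← harc' z]
    rfl
  · rintro z ⟨hz1, rfl⟩
    left; right
    have : i = addOrderOf c := by
      have h3 : i • c = 0 := by rw [hz1] at hj; simpa using hj
      rw [← addOrderOf_dvd_iff_zsmul_eq_zero] at h3
      exact le_antisymm (by omega) (Int.le_of_dvd (by omega) h3)
    exact ⟨1, by omega, by omega, by simp⟩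

theorem transfer (hΓ : IsRose Γ a b c) (hc : c ≠ 0) {g x z : G}
    (hb : (π g : G ⧸ AddSubgroup.zmultiples c) ≠ π (g + b))
    (hxz : (x = g ∧ z = g + c) ∨ (x = g + c ∧ z = g)) :
    Spans Γ c (inl z) (inl x) (cell c g ∪ (cell c (g + b) \ {inl (g + b)})) {g + b + c} := by
  have key : Spans Γ c (inl (g + c)) (inl g) (cell c g ∪ (cell c (g + b) \ {inl (g + b)}))
      {g + b + c} := by
    have h1 := hΓ.rem_two hc g
    have h2 := (hΓ.rem hc (g + b)).symm
    have hadj := (hΓ.right (g + c)).symm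
    rw [add_right_comm] at hadj
    have hdc : Disjoint (cell c g) (cell c (g + b)) := disjoint_cells (by simpa using hb)
    have e1 : (inl g : G ⊕ G) ∈ cell c g := by simp
    have e2 : (inr (g + c) : G ⊕ G) ∈ cell c g := by simp
    rw [Set.disjoint_left] at hdc
    refine (((h1.append h2 (hΓ.right g) ?_).append (Spans.single (inr (g + c))) hadj ?_).append
      (Spans.single (inl g)) (hΓ.spoke_add g).symm ?_).of ?_ ?_
    all_goals (try rw [Set.disjoint_left])
    all_goals grind
  rcases hxz with ⟨rfl, rfl⟩ | ⟨rfl, rfl⟩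
  · exact key
  · exact key.symm

theorem strip_step (hΓ : IsRose Γ a b c) (hc : c ≠ 0) (h : Strip Γ b c x g W y y' F) {z : G}
    (hz : (x = g ∧ z = g + a + c) ∨ (x = g + c ∧ z = g + a))
    (h1 : π (g + a) ∉ W) (h2 : π (g + a + b) ∉ W)
    (hb : (π (g + a) : G ⧸ AddSubgroup.zmultiples c) ≠ π (g + a + b)) :
    Strip Γ b c z (g + a) (W ∪ {π (g + a), π (g + a + b)}) y y'
      (F ∪ {g + a + b + c}) := by
  obtain ⟨S₁, S₂, F₁, F₂, hx, hL, hR, hd, hS, hF⟩ := h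
  have hxz : (x + a = g + a ∧ z = g + a + c) ∨ (x + a = g + a + c ∧ z = g + a) := by
    rcases hz with ⟨rfl, rfl⟩ | ⟨rfl, rfl⟩
    · exact Or.inl ⟨rfl, rfl⟩
    · exact Or.inr ⟨by abel, rfl⟩
  have ht := hΓ.transfer hc hb hxz
  have d1 : Disjoint (cells c W) (cell c (g + a)) := disjoint_cells (by simpa using h1)
  have d2 : Disjoint (cells c W) (cell c (g + a + b)) := disjoint_cells (by simpa using h2)
  have d3 : Disjoint (cell c (g + a)) (cell c (g + a + b)) := disjoint_cells (by simpa using hb)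
  have hself := self_mem_cell c (g + a + b)
  have hcells : ∀ w : G ⊕ G, w ∈ cells c (W ∪ {π (g + a), π (g + a + b)}) ↔
      w ∈ cells c W ∨ w ∈ cell c (g + a) ∨ w ∈ cell c (g + a + b) := fun w => Iff.rfl
  have hadj := hΓ.left (g + b)
  rw [add_right_comm] at hadj
  rw [Set.disjoint_left] at d1 d2 d3 hd
  refine ⟨_, _, _, _, ?_, ht.append hL (hΓ.left x).symm ?_,
    hR.append (Spans.single (inl (g + a + b))) hadj ?_, ?_, ?_, ?_⟩
  · tauto
  all_goals (try rw [Set.disjoint_left])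
  all_goals grind

theorem strip_close (hΓ : IsRose Γ a b c) (hc : c ≠ 0) (h : Strip Γ b c x g W y y' F)
    (hy : Γ.Adj y y') (h1 : π (g + a) ∉ W) (h2 : π (g + a + b) ∉ W)
    (hb : (π (g + a) : G ⧸ AddSubgroup.zmultiples c) ≠ π (g + a + b)) :
    Closed Γ c (cells c (W ∪ {π (g + a), π (g + a + b)})) (F ∪ {g + a + b + c}) := by
  obtain ⟨S₁, S₂, F₁, F₂, hx, hL, hR, hd, hS, hF⟩ := h
  obtain ⟨s, hs, rfl⟩ : ∃ s, (s = 0 ∨ s = c) ∧ x = g + s := by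
    rcases hx with rfl | rfl
    · exact ⟨0, Or.inl rfl, by simp⟩
    · exact ⟨c, Or.inr rfl, rfl⟩
  have hf1 := hΓ.full hc (g + s + a) (Or.inl rfl)
  have hf2 := hΓ.full hc (g + a + b) hs
  have e1 : cell c (g + s + a) = cell c (g + a) := by
    rcases hs with rfl | rfl
    · simp
    · rw [add_right_comm, cell, mk_add_c]
  rw [e1, add_zero] at hf1
  have d1 : Disjoint (cells c W) (cell c (g + a)) := disjoint_cells (by simpa using h1)
  have d2 : Disjoint (cells c W) (cell c (g + a + b)) := disjoint_cells (by simpa using h2)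
  have d3 : Disjoint (cell c (g + a)) (cell c (g + a + b)) := disjoint_cells (by simpa using hb)
  have hcells : ∀ w : G ⊕ G, w ∈ cells c (W ∪ {π (g + a), π (g + a + b)}) ↔
      w ∈ cells c W ∨ w ∈ cell c (g + a) ∨ w ∈ cell c (g + a + b) := fun w => Iff.rfl
  have hadj := hΓ.left (g + b)
  have hadj' := (hΓ.right (g + s + a)).symm
  rw [add_right_comm] at hadj
  rw [show g + s + a + b = g + a + b + s by abel] at hadj'
  rw [Set.disjoint_left] at d1 d2 d3 hd
  refine ⟨_, _, (((hL.append hR hy ?_).append hf2 hadj ?_).append hf1.symm hadj' ?_).of ?_ ?_,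
    (hΓ.left (g + s)).symm⟩
  all_goals (try rw [Set.disjoint_left])
  all_goals grind

theorem strip_close_right (hΓ : IsRose Γ a b c) (hc : c ≠ 0)
    (h : Strip Γ b c x g W (inr (x + a)) (inl (x + a)) F) (h2 : π (g + a + b) ∉ W) :
    Closed Γ c (cells c (W ∪ {π (g + a + b)})) (F ∪ {g + a + b + c}) := by
  obtain ⟨S₁, S₂, F₁, F₂, hx, hL, hR, hd, hS, hF⟩ := h
  obtain ⟨s, hs, rfl⟩ : ∃ s, (s = 0 ∨ s = c) ∧ x = g + s := by
    rcases hx with rfl | rfl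
    · exact ⟨0, Or.inl rfl, by simp⟩
    · exact ⟨c, Or.inr rfl, rfl⟩
  have hf2 := hΓ.full hc (g + a + b) hs
  have d2 : Disjoint (cells c W) (cell c (g + a + b)) := disjoint_cells (by simpa using h2)
  have hcells : ∀ w : G ⊕ G, w ∈ cells c (W ∪ {π (g + a + b)}) ↔
      w ∈ cells c W ∨ w ∈ cell c (g + a + b) := fun w => Iff.rfl
  have hadj := (hΓ.left (g + b)).symm
  have hadj' := hΓ.right (g + s + a)
  rw [add_right_comm] at hadj
  rw [show g + s + a + b = g + a + b + s by abel] at hadj'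
  rw [Set.disjoint_left] at d2 hd
  refine ⟨_, _, ((hL.append hf2.symm hadj' ?_).append hR.symm hadj ?_).of ?_ ?_,
    (hΓ.left (g + s)).symm⟩
  all_goals (try rw [Set.disjoint_left])
  all_goals grind

end IsRose

end

theorem nsmul_inj_of_lt {Q : Type*} [AddCommGroup Q] {A : Q} {n i j : ℕ} (hn : n ≤ addOrderOf A)
    (hi : i < n) (hj : j < n) (h : i • A = j • A) : i = j :=
  nsmul_injOn_Iio_addOrderOf (Set.mem_Iio.2 (by omega)) (Set.mem_Iio.2 (by omega)) h

theorem ladder_cells_succ {Q : Type*} [AddCommGroup Q] (A B : Q) (n : ℕ) :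
    {w | ∃ i < n + 1, w = i • A ∨ w = B + i • A} =
      {w | ∃ i < n, w = i • A ∨ w = B + i • A} ∪ {n • A, B + n • A} := by
  ext w
  simp only [Set.mem_ofPred_eq, Set.mem_union, Nat.exists_lt_succ_right]
  rfl

theorem Strip.mono {Γ : SimpleGraph (G ⊕ G)} {b c x g : G}
    {W : Set (G ⧸ AddSubgroup.zmultiples c)} {F F' : Set G} {y y' : G ⊕ G}
    (h : Strip Γ b c x g W y y' F) (hF : F' ⊆ F) : Strip Γ b c x g W y y' F' := by
  obtain ⟨S₁, S₂, F₁, F₂, hx, hL, hR, hd, hS, hF'⟩ := h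
  exact ⟨S₁, S₂, F₁, F₂, hx, hL, hR, hd, hS, hF.trans hF'⟩

namespace IsRose

variable [Finite G] {Γ : SimpleGraph (G ⊕ G)} {a b c : G}

theorem strip_run (hΓ : IsRose Γ a b c) (hc : c ≠ 0) {n : ℕ}
    (hn : n ≤ addOrderOf (π a : G ⧸ AddSubgroup.zmultiples c))
    (hB : ∀ i < n, ∀ j < n, (i • π a : G ⧸ AddSubgroup.zmultiples c) ≠ π b + j • π a)
    {j : ℕ} (hj : j < n) :
    ∃ s, (s = 0 ∨ s = c) ∧ ∀ h, (π h : G ⧸ AddSubgroup.zmultiples c) = π b →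
      Strip Γ b c (j • a + s) (j • a) {w | ∃ i < j + 1, w = i • π a ∨ w = π b + i • π a} (inr h)
        (inl h) {z | ∃ i < j + 1, (1 ≤ i ∨ h = b) ∧ z = b + c + i • a} := by
  induction j with
  | zero =>
    refine ⟨0, Or.inl rfl, fun h hh => ?_⟩
    have := hΓ.strip_base hc 0 (h := h) (by simpa using hh)
      (by simpa using hB 0 hj 0 hj)
    convert this using 1
    · simp
    · simp
    · ext w; simp
    · ext w; simp
  | succ j ih =>
    obtain ⟨s, hs, ih⟩ := ih (by omega)
    obtain ⟨s', hs', hz⟩ : ∃ s', (s' = 0 ∨ s' = c) ∧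
        ((j • a + s = j • a ∧ j • a + a + s' = j • a + a + c) ∨
        (j • a + s = j • a + c ∧ j • a + a + s' = j • a + a)) := by
      rcases hs with rfl | rfl
      · exact ⟨c, by simp⟩
      · exact ⟨0, by simp⟩
    refine ⟨s', hs', fun h hh => ?_⟩
    have e1 : (π (j • a + a) : G ⧸ AddSubgroup.zmultiples c) = (j + 1) • π a := by
      rw [← succ_nsmul, QuotientAddGroup.mk_nsmul]
    have e2 : (π (j • a + a + b) : G ⧸ AddSubgroup.zmultiples c) = π b + (j + 1) • π a := by
      rw [QuotientAddGroup.mk_add, e1, add_comm]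
    have := hΓ.strip_step hc (ih h hh) hz ?_ ?_ ?_
    · rw [e1, e2, ← ladder_cells_succ, ← succ_nsmul] at this
      refine this.mono ?_
      rintro z ⟨i, hi, hi', rfl⟩
      rcases Nat.lt_succ_iff_lt_or_eq.1 hi with h1 | rfl
      · exact Or.inl ⟨i, h1, hi', rfl⟩
      · right; rw [Set.mem_singleton_iff]; abel
    · rw [e1]
      rintro ⟨i, hi, h1 | h1⟩
      · have := nsmul_inj_of_lt hn hj (by omega) h1; omega
      · exact hB _ hj _ (by omega) h1
    · rw [e2]
      rintro ⟨i, hi, h1 | h1⟩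
      · exact hB i (by omega) _ hj h1.symm
      · have := nsmul_inj_of_lt hn hj (by omega) (add_left_cancel h1); omega
    · rw [e1, e2]
      exact hB _ hj _ hj

theorem ladder (hΓ : IsRose Γ a b c) (hc : c ≠ 0) {n : ℕ} (hn2 : 2 ≤ n)
    (hn : n ≤ addOrderOf (π a : G ⧸ AddSubgroup.zmultiples c))
    (hB : ∀ i < n, ∀ j < n, (i • π a : G ⧸ AddSubgroup.zmultiples c) ≠ π b + j • π a) :
    Closed Γ c (cells c {w | ∃ i < n, w = i • π a ∨ w = π b + i • π a})
      {z | ∃ i < n, z = b + c + i • a} := by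
  obtain ⟨j, rfl⟩ : ∃ j, n = j + 2 := ⟨n - 2, by omega⟩
  obtain ⟨s, hs, h⟩ := hΓ.strip_run hc hn hB (j := j) (by omega)
  have hj : j + 1 < j + 2 := by omega
  have e1 : (π (j • a + a) : G ⧸ AddSubgroup.zmultiples c) = (j + 1) • π a := by
    rw [← succ_nsmul, QuotientAddGroup.mk_nsmul]
  have e2 : (π (j • a + a + b) : G ⧸ AddSubgroup.zmultiples c) = π b + (j + 1) • π a := by
    rw [QuotientAddGroup.mk_add, e1, add_comm]
  have := hΓ.strip_close hc (h b rfl) (hΓ.spoke b).symm ?_ ?_ ?_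
  · rw [e1, e2, ← ladder_cells_succ, ← succ_nsmul] at this
    refine this.of (fun _ => Iff.rfl) ?_
    rintro z ⟨i, hi, rfl⟩
    rcases Nat.lt_succ_iff_lt_or_eq.1 hi with h1 | rfl
    · exact Or.inl ⟨i, h1, Or.inr rfl, rfl⟩
    · right; rw [Set.mem_singleton_iff]; abel
  · rw [e1]
    rintro ⟨i, hi, h1 | h1⟩
    · have := nsmul_inj_of_lt hn hj (by omega) h1; omega
    · exact hB _ hj _ (by omega) h1
  · rw [e2]
    rintro ⟨i, hi, h1 | h1⟩
    · exact hB i (by omega) _ hj h1.symm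
    · have := nsmul_inj_of_lt hn hj (by omega) (add_left_cancel h1); omega
  · rw [e1, e2]
    exact hB _ hj _ hj

/-- The variant of `ladder` with one cell more, for `b ∈ n • a + ⟨c⟩`. -/
theorem ladder_succ (hΓ : IsRose Γ a b c) (hc : c ≠ 0) {n : ℕ} (hn1 : 1 ≤ n)
    (hn : 2 * n < addOrderOf (π a : G ⧸ AddSubgroup.zmultiples c))
    (hb : (π b : G ⧸ AddSubgroup.zmultiples c) = n • π a) :
    Closed Γ c (cells c {w | ∃ i < 2 * n + 1, w = i • π a})
      {z | ∃ i < n, z = b + c + a + i • a} := by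
  obtain ⟨j, rfl⟩ : ∃ j, n = j + 1 := ⟨n - 1, by omega⟩
  obtain ⟨s, hs, h⟩ := hΓ.strip_run hc (n := j + 1) (by omega)
    (by
      intro i hi i' hi' h
      rw [hb, ← add_nsmul] at h
      have := nsmul_inj_of_lt le_rfl (by omega) (by omega) h
      omega) (j := j) (by omega)
  have := hΓ.strip_close_right hc (h (j • a + s + a) ?_) ?_
  · refine this.of ?_ ?_
    · intro x
      suffices ∀ w : G ⧸ AddSubgroup.zmultiples c,
          w ∈ ({w | ∃ i < j + 1, w = i • π a ∨ w = π b + i • π a} ∪ {π (j • a + a + b)} : Set _) ↔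
            w ∈ {w | ∃ i < 2 * (j + 1) + 1, w = i • π a} from this _
      intro w
      have e : (π (j • a + a + b) : G ⧸ AddSubgroup.zmultiples c) = (2 * (j + 1)) • π a := by
        rw [QuotientAddGroup.mk_add, hb, ← succ_nsmul, QuotientAddGroup.mk_nsmul, ← add_nsmul]
        congr 1; ring
      rw [e, hb]
      simp only [← add_nsmul, Set.mem_union, Set.mem_ofPred_eq, Set.mem_singleton_iff]
      constructor
      · rintro (⟨i, hi, rfl | rfl⟩ | rfl)
        · exact ⟨i, by omega, rfl⟩
        · exact ⟨j + 1 + i, by omega, rfl⟩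
        · exact ⟨_, by omega, rfl⟩
      · rintro ⟨i, hi, rfl⟩
        rcases Nat.lt_or_ge i (j + 1) with h1 | h1
        · exact Or.inl ⟨i, h1, Or.inl rfl⟩
        · obtain ⟨t, rfl⟩ := Nat.exists_eq_add_of_le h1
          rcases Nat.lt_or_ge t (j + 1) with h2 | h2
          · exact Or.inl ⟨t, h2, Or.inr rfl⟩
          · right; congr 1; omega
    · rintro z ⟨i, hi, rfl⟩
      rcases Nat.lt_or_ge i j with h1 | h1
      · left; exact ⟨i + 1, by omega, Or.inl (by omega), by rw [succ_nsmul]; abel⟩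
      · right
        obtain rfl : i = j := by omega
        rw [Set.mem_singleton_iff]; abel
  · rw [hb]
    rcases hs with rfl | rfl
    · simp [succ_nsmul]
    · simp [succ_nsmul]
  · rintro ⟨i, hi, h1⟩
    rw [QuotientAddGroup.mk_add, hb, ← succ_nsmul, QuotientAddGroup.mk_nsmul, ← add_nsmul,
      ← add_nsmul] at h1
    rcases h1 with h1 | h1
    · have := nsmul_inj_of_lt le_rfl (by omega) (by omega) h1; omega
    · have := nsmul_inj_of_lt le_rfl (by omega) (by omega) h1; omega

end IsRose

theorem IsRose.neg_left {Γ : SimpleGraph (G ⊕ G)} {a b c : G} (hΓ : IsRose Γ a b c) :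
    IsRose Γ (-a) b c where
  left g := by simpa using (hΓ.left (g + -a)).symm
  right := hΓ.right
  spoke := hΓ.spoke
  spoke_add := hΓ.spoke_add

theorem IsRose.neg_right {Γ : SimpleGraph (G ⊕ G)} {a b c : G} (hΓ : IsRose Γ a b c) :
    IsRose Γ a (-b) c where
  left := hΓ.left
  right g := by simpa using (hΓ.right (g + -b)).symm
  spoke := hΓ.spoke
  spoke_add := hΓ.spoke_add

theorem mem_zmultiples_iff_exists_lt {Q : Type*} [AddCommGroup Q] [Finite Q] {A w : Q} :
    w ∈ AddSubgroup.zmultiples A ↔ ∃ i < addOrderOf A, w = i • A := by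
  constructor
  · intro h
    rw [← mem_multiples_iff_mem_zmultiples, AddSubmonoid.mem_multiples_iff] at h
    obtain ⟨n, rfl⟩ := h
    exact ⟨n % addOrderOf A, Nat.mod_lt _ (addOrderOf_pos A), (mod_addOrderOf_nsmul A n).symm⟩
  · rintro ⟨i, -, rfl⟩
    exact AddSubgroup.nsmul_mem_zmultiples A i

theorem ne_add_of_notMem_zmultiples {Q : Type*} [AddCommGroup Q] {A B : Q}
    (hB : B ∉ AddSubgroup.zmultiples A) (i j : ℕ) : i • A ≠ B + j • A := by
  intro h
  apply hB
  rw [eq_sub_of_add_eq h.symm]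
  exact sub_mem (AddSubgroup.nsmul_mem_zmultiples A i) (AddSubgroup.nsmul_mem_zmultiples A j)

namespace IsRose

variable [Finite G] {Γ : SimpleGraph (G ⊕ G)} {a b c : G}

/-- The case `b ∉ ⟨a, c⟩`. -/
theorem closed_of_notMem_zmultiples (hΓ : IsRose Γ a b c) (hc : c ≠ 0)
    (hgen : ∀ w : G ⧸ AddSubgroup.zmultiples c, ∃ x y : ℤ, w = x • π a + y • π b)
    (hA : (π a : G ⧸ AddSubgroup.zmultiples c) ≠ 0)
    (hB : (π b : G ⧸ AddSubgroup.zmultiples c) ∉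
      AddSubgroup.zmultiples (π a : G ⧸ AddSubgroup.zmultiples c)) :
    Closed Γ c Set.univ ∅ := by
  set A : G ⧸ AddSubgroup.zmultiples c := π a with hAdef
  set B : G ⧸ AddSubgroup.zmultiples c := π b with hBdef
  set n := addOrderOf A with hn
  have hn2 : 2 ≤ n := two_le_addOrderOf hA
  set e := addOrderOf (π B : (G ⧸ AddSubgroup.zmultiples c) ⧸ AddSubgroup.zmultiples A) with he
  have he2 : 2 ≤ e := two_le_addOrderOf (by rwa [Ne, QuotientAddGroup.eq_zero_iff])
  have hrow : ∀ {i i' j j' : ℕ}, i < e → i' < e → i • B + j • A = i' • B + j' • A → i = i' := by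
    intro i i' j j' hi hi' h
    have := congrArg
      (QuotientAddGroup.mk : _ → (G ⧸ AddSubgroup.zmultiples c) ⧸ AddSubgroup.zmultiples A) h
    simp only [QuotientAddGroup.mk_add, QuotientAddGroup.mk_nsmul, mk_c, smul_zero, add_zero]
      at this
    exact nsmul_inj_of_lt le_rfl hi hi' this
  have key : ∀ i, i + 2 ≤ e → Closed Γ c
      (cells c {w | ∃ i' < i + 2, ∃ j < n, w = i' • B + j • A})
      {z | ∃ j < n, z = (i + 1) • (b + c) + j • a} := by
    intro i
    induction i with
    | zero =>
      intro _
      have := hΓ.ladder hc hn2 le_rfl (fun i _ j _ => ne_add_of_notMem_zmultiples hB i j)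
      refine this.of (fun x => ?_) (by simp)
      suffices ∀ w, w ∈ {w | ∃ i < n, w = i • A ∨ w = B + i • A} ↔
        w ∈ {w | ∃ i' < 0 + 2, ∃ j < n, w = i' • B + j • A} from this _
      intro w
      constructor
      · rintro ⟨j, hj, rfl | rfl⟩
        · exact ⟨0, by omega, j, hj, by simp⟩
        · exact ⟨1, by omega, j, hj, by simp⟩
      · rintro ⟨i, hi, j, hj, rfl⟩
        interval_cases i
        · exact ⟨j, hj, Or.inl (by simp)⟩
        · exact ⟨j, hj, Or.inr (by simp)⟩
    | succ i ih =>
      intro hi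
      have e1 : ∀ j : ℕ, (π ((i + 1) • (b + c) + b + j • a) : G ⧸ AddSubgroup.zmultiples c) =
          (i + 2) • B + j • A := by
        intro j
        simp only [QuotientAddGroup.mk_add, QuotientAddGroup.mk_nsmul, mk_c, add_zero]
        rw [← succ_nsmul]
      have := hΓ.run_add hc (ih (by omega)) (q := (i + 1) • (b + c)) hn2
        (fun j hj => ⟨j, hj, rfl⟩) ?_ ?_
      · refine this.of (fun x => ?_) ?_
        · simp only [e1]
          suffices ∀ w, w ∈ {w | ∃ i' < i + 2, ∃ j < n, w = i' • B + j • A} ∪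
            {x | ∃ j < n, x = (i + 2) • B + j • A} ↔
            w ∈ {w | ∃ i' < i + 1 + 2, ∃ j < n, w = i' • B + j • A} from this _
          intro w
          simp only [Set.mem_union, Set.mem_ofPred_eq]
          rw [show i + 1 + 2 = i + 2 + 1 by ring]
          exact Nat.exists_lt_succ_right.symm
        · rintro z ⟨j, hj, rfl⟩
          exact ⟨j, hj, by rw [succ_nsmul _ (i + 1)]; abel⟩
      · intro j hj j' hj' h
        rw [e1, e1] at h
        exact nsmul_inj_of_lt le_rfl hj hj' (add_left_cancel h)
      · intro j hj
        rw [e1]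
        rintro ⟨i', hi', j', hj', h⟩
        have := hrow (by omega) (by omega) h
        omega
  refine (key (e - 2) (by omega)).of (fun x => ?_) (by simp)
  refine iff_of_true ?_ (Set.mem_univ x)
  suffices ∀ w, w ∈ {w | ∃ i' < e - 2 + 2, ∃ j < n, w = i' • B + j • A} from this _
  intro w
  obtain ⟨x, y, rfl⟩ := hgen w
  have h1 : (π (y • B) : (G ⧸ AddSubgroup.zmultiples c) ⧸ AddSubgroup.zmultiples A) ∈
      AddSubgroup.zmultiples (π B : (G ⧸ AddSubgroup.zmultiples c) ⧸ AddSubgroup.zmultiples A) :=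
    ⟨y, rfl⟩
  rw [mem_zmultiples_iff_exists_lt] at h1
  obtain ⟨i, hi, h1⟩ := h1
  rw [← QuotientAddGroup.mk_nsmul, eq_comm, QuotientAddGroup.eq] at h1
  have h2 := add_mem h1 (AddSubgroup.zsmul_mem_zmultiples A x)
  obtain ⟨j, hj, h2⟩ := mem_zmultiples_iff_exists_lt.1 h2
  exact ⟨i, by omega, j, hj, by rw [← h2]; abel⟩

/-- The case `b ∈ β • a + ⟨c⟩` with `2 ≤ β` and `2 * β` at most the order of `a` modulo `c`. -/
theorem closed_of_eq_nsmul (hΓ : IsRose Γ a b c) (hc : c ≠ 0)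
    (hgen : ∀ w : G ⧸ AddSubgroup.zmultiples c, ∃ x y : ℤ, w = x • π a + y • π b)
    {β : ℕ} (hβ : 2 ≤ β) (hβ' : 2 * β ≤ addOrderOf (π a : G ⧸ AddSubgroup.zmultiples c))
    (hB : (π b : G ⧸ AddSubgroup.zmultiples c) = β • π a) :
    Closed Γ c Set.univ ∅ := by
  set A : G ⧸ AddSubgroup.zmultiples c := π a with hAdef
  set d := addOrderOf A with hd
  have hQ : ∀ w, ∃ i < d, w = i • A := by
    intro w
    rw [← mem_zmultiples_iff_exists_lt]
    obtain ⟨x, y, rfl⟩ := hgen w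
    rw [hB]
    exact add_mem (AddSubgroup.zsmul_mem_zmultiples A x)
      (zsmul_mem (AddSubgroup.nsmul_mem_zmultiples A β) y)
  have hstep : ∀ {N n : ℕ} {q : G}, 2 ≤ n → n ≤ β → N + n ≤ d → π q + β • A = N • A →
      Closed Γ c (cells c {w | ∃ i < N, w = i • A}) {z | ∃ j < β, z = q + j • a} →
      Closed Γ c (cells c {w | ∃ i < N + n, w = i • A}) {z | ∃ j < n, z = q + b + c + j • a} := by
    intro N n q hn hnβ hNn hq h
    have e1 : ∀ j : ℕ, (π (q + b + j • a) : G ⧸ AddSubgroup.zmultiples c) = (N + j) • A := by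
      intro j
      rw [QuotientAddGroup.mk_add, QuotientAddGroup.mk_add, hB, hq, QuotientAddGroup.mk_nsmul,
        add_nsmul]
    have := hΓ.run_add hc h hn (q := q) (fun j hj => ⟨j, by omega, rfl⟩) ?_ ?_
    · refine this.of (fun x => ?_) subset_rfl
      simp only [e1]
      suffices ∀ w, w ∈ {w | ∃ i < N, w = i • A} ∪ {x | ∃ j < n, x = (N + j) • A} ↔
        w ∈ {w | ∃ i < N + n, w = i • A} from this _
      intro w
      constructor
      · rintro (⟨i, hi, rfl⟩ | ⟨i, hi, rfl⟩)
        · exact ⟨i, by omega, rfl⟩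
        · exact ⟨N + i, by omega, rfl⟩
      · rintro ⟨i, hi, rfl⟩
        rcases Nat.lt_or_ge i N with h1 | h1
        · exact Or.inl ⟨i, h1, rfl⟩
        · exact Or.inr ⟨i - N, by omega, by congr 1; omega⟩
    · intro i hi j hj h
      rw [e1, e1] at h
      have := nsmul_inj_of_lt le_rfl (by omega) (by omega) h
      omega
    · intro j hj
      rw [e1]
      rintro ⟨i, hi, h⟩
      have := nsmul_inj_of_lt le_rfl (by omega) (by omega) h
      omega
  have hdone : ∀ {F}, Closed Γ c (cells c {w | ∃ i < d, w = i • A}) F → Closed Γ c Set.univ ∅ :=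
    fun h => h.of (fun x => iff_of_true (hQ _) (Set.mem_univ x)) (Set.empty_subset _)
  have hloop : ∀ r N : ℕ, ∀ q : G, N + r = d → r % β ≠ 1 → π q + β • A = N • A →
      Closed Γ c (cells c {w | ∃ i < N, w = i • A}) {z | ∃ j < β, z = q + j • a} →
      Closed Γ c Set.univ ∅ := by
    intro r
    induction r using Nat.strong_induction_on with
    | _ r ih =>
      intro N q hN hr hq h
      rcases Nat.lt_or_ge r β with hrβ | hrβ
      · rw [Nat.mod_eq_of_lt hrβ] at hr
        rcases Nat.eq_zero_or_pos r with rfl | hr0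
        · rw [add_zero] at hN; rw [hN] at h; exact hdone h
        · have := hstep (n := r) (by omega) hrβ.le hN.le hq h
          rw [hN] at this
          exact hdone this
      · have h1 := hstep (n := β) hβ le_rfl (by omega) hq h
        refine ih (r - β) (by omega) (N + β) (q + b + c) (by omega) ?_ ?_ h1
        · rwa [← Nat.mod_eq_sub_mod hrβ]
        · rw [mk_add_c, QuotientAddGroup.mk_add, hB, hq, add_nsmul]
  by_cases hr : (d - 2 * β) % β = 1
  · have hlt : 2 * β < d := by
      by_contra h
      rw [show d - 2 * β = 0 by omega, Nat.zero_mod] at hr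
      omega
    refine hloop (d - (2 * β + 1)) (2 * β + 1) (b + c + a) (by omega) ?_ ?_
      (hΓ.ladder_succ hc (by omega) hlt hB)
    · obtain ⟨t, ht⟩ : ∃ t, d - 2 * β = 1 + β * t :=
        ⟨(d - 2 * β) / β, by rw [← hr]; exact (Nat.mod_add_div _ _).symm⟩
      rw [show d - (2 * β + 1) = β * t by omega, Nat.mul_mod_right]
      omega
    · rw [QuotientAddGroup.mk_add, mk_add_c, hB, add_right_comm, ← add_nsmul, ← succ_nsmul]
      congr 1; ring
  · refine hloop (d - 2 * β) (2 * β) (b + c) (by omega) hr ?_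
      ((hΓ.ladder hc hβ (show β ≤ addOrderOf A by omega) ?_).of (fun x => ?_) subset_rfl)
    · rw [mk_add_c, hB, ← add_nsmul, two_mul]
    · intro i hi j hj h
      rw [hB, ← add_nsmul] at h
      have := nsmul_inj_of_lt (A := A) le_rfl (by omega) (by omega) h
      omega
    · suffices ∀ w, w ∈ {w | ∃ i < β, w = i • A ∨ w = π b + i • A} ↔
        w ∈ {w | ∃ i < 2 * β, w = i • A} from this _
      intro w
      rw [hB]
      simp only [← add_nsmul]
      constructor
      · rintro ⟨i, hi, rfl | rfl⟩
        · exact ⟨i, by omega, rfl⟩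
        · exact ⟨β + i, by omega, rfl⟩
      · rintro ⟨i, hi, rfl⟩
        rcases Nat.lt_or_ge i β with h1 | h1
        · exact ⟨i, h1, Or.inl rfl⟩
        · exact ⟨i - β, by omega, Or.inr (by congr 1; omega)⟩

/-- The case `a, b, a + b, a - b ∉ ⟨c⟩`. -/
theorem closed_of_ne (hΓ : IsRose Γ a b c) (hc : c ≠ 0)
    (hgen : ∀ w : G ⧸ AddSubgroup.zmultiples c, ∃ x y : ℤ, w = x • π a + y • π b)
    (hA : (π a : G ⧸ AddSubgroup.zmultiples c) ≠ 0) (hB : (π b : G ⧸ AddSubgroup.zmultiples c) ≠ 0)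
    (hAB : (π b : G ⧸ AddSubgroup.zmultiples c) ≠ π a)
    (hAB' : (π b : G ⧸ AddSubgroup.zmultiples c) ≠ -π a) :
    Closed Γ c Set.univ ∅ := by
  by_cases hmem : (π b : G ⧸ AddSubgroup.zmultiples c) ∈
      AddSubgroup.zmultiples (π a : G ⧸ AddSubgroup.zmultiples c)
  swap
  · exact hΓ.closed_of_notMem_zmultiples hc hgen hA hmem
  obtain ⟨β, hβ, h⟩ := mem_zmultiples_iff_exists_lt.1 hmem
  have h0 : β ≠ 0 := by rintro rfl; exact hB (by simpa using h)
  have h1 : β ≠ 1 := by rintro rfl; exact hAB (by simpa using h)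
  have hneg : (π (-b) : G ⧸ AddSubgroup.zmultiples c) =
      (addOrderOf (π a : G ⧸ AddSubgroup.zmultiples c) - β) • π a := by
    rw [QuotientAddGroup.mk_neg, h, neg_eq_iff_add_eq_zero, ← add_nsmul,
      Nat.add_sub_cancel' hβ.le, addOrderOf_nsmul_eq_zero]
  have h2 : addOrderOf (π a : G ⧸ AddSubgroup.zmultiples c) - β ≠ 1 := by
    intro h3
    rw [h3, one_nsmul, QuotientAddGroup.mk_neg] at hneg
    exact hAB' (neg_eq_iff_eq_neg.1 hneg)
  rcases Nat.le_total (2 * β) (addOrderOf (π a : G ⧸ AddSubgroup.zmultiples c)) with h3 | h3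
  · exact hΓ.closed_of_eq_nsmul hc hgen (by omega) h3 h
  · refine hΓ.neg_right.closed_of_eq_nsmul hc ?_ (by omega) (by omega) hneg
    intro w
    obtain ⟨x, y, rfl⟩ := hgen w
    exact ⟨x, -y, by simp⟩

end IsRose

/-- Exchanging the two sides of a generalized rose window graph. -/
def flip (x : G ⊕ G) : G ⊕ G := x.elim (fun g => inr (-g)) (fun g => inl (-g))

theorem flip_involutive : Function.Involutive (flip : G ⊕ G → G ⊕ G) := by
  rintro (x | x) <;> simp [flip]

theorem IsRose.flip {Γ : SimpleGraph (G ⊕ G)} {a b c : G} (hΓ : IsRose Γ a b c) :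
    IsRose (Γ.comap flip) b a c where
  left g := by simpa [RoseWindow.flip] using (hΓ.right (-b + -g)).symm
  right g := by simpa [RoseWindow.flip] using (hΓ.left (-a + -g)).symm
  spoke g := (hΓ.spoke (-g)).symm
  spoke_add g := by simpa [RoseWindow.flip] using (hΓ.spoke_add (-c + -g)).symm

theorem Closed.of_flip {Γ : SimpleGraph (G ⊕ G)} {c : G}
    (h : Closed (Γ.comap flip) c Set.univ ∅) : Closed Γ c Set.univ ∅ := by
  obtain ⟨p, q, ⟨l, hc, hn, hh, hl, hS, -⟩, hadj⟩ := h
  refine ⟨flip p, flip q, ⟨l.map flip, ?_, hn.map flip_involutive.injective, by simp [hh],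
    by simp [hl], fun x => iff_of_true ?_ (Set.mem_univ x), by simp⟩, hadj⟩
  · rw [List.isChain_map]; exact hc
  · rw [List.mem_map]; exact ⟨flip x, (hS _).2 (Set.mem_univ _), flip_involutive x⟩

namespace IsRose

variable [Finite G] {Γ : SimpleGraph (G ⊕ G)} {a b c : G}

theorem extend_two (hΓ : IsRose Γ a b c) (hc : c ≠ 0) {τ : ℤ} (hb : b = a + τ • c) {g s : G}
    (hs : s = 0 ∨ s = c) {S : Set (G ⊕ G)} (h : Spans Γ c (inl g) (inr (g + s)) S ∅)
    (h1 : Disjoint S (cell c (g + a))) (h2 : Disjoint S (cell c (g + a + a)))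
    (h12 : Disjoint (cell c (g + a)) (cell c (g + a + a))) :
    ∃ w s', (s' = 0 ∨ s' = c) ∧ (π w : G ⧸ AddSubgroup.zmultiples c) = π (g + a + a) ∧
      Spans Γ c (inl w) (inr (w + s')) (S ∪ cell c (g + a) ∪ cell c (g + a + a)) ∅ := by
  have hk := two_le_addOrderOf hc
  obtain ⟨σ, hσ⟩ : ∃ σ : ℤ, s + τ • c = σ • c := by
    rcases hs with rfl | rfl
    · exact ⟨τ, by simp⟩
    · exact ⟨1 + τ, by rw [add_smul, one_smul]⟩
  obtain ⟨q, hq1, hq2, hq⟩ := exists_zsmul_eq c 1 σ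
  rw [← hq] at hσ
  have a1 := (hΓ.arc (g + a) (i := 0) (j := 2 * (q - 1)) (by omega) (by omega)).symm
  have a2 := hΓ.arc (g + a) (i := 2 * q - 1) (j := 2 * addOrderOf c - 1) (by omega) (by omega)
  rw [zig_zero, zig_even] at a1
  rw [zig_odd, zig_period_sub_one] at a2
  set w := g + a + (q - 1) • c + a with hw
  have hwc : w + c = g + a + a + q • c := by rw [hw, sub_smul, one_smul]; abel
  have hwcell : cell c w = cell c (g + a + a) := by
    rw [hw, add_right_comm _ _ a, cell, cell, QuotientAddGroup.mk_add, mk_zsmul_c, add_zero]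
  have hlast : ∃ s', (s' = 0 ∨ s' = c) ∧ ∃ y F, Γ.Adj (inr (g + a)) y ∧
      Spans Γ c y (inr (w + s')) (cell c (g + a + a) \ {inl w}) F := by
    rw [← hwcell]
    rcases hs with rfl | rfl
    · refine ⟨0, Or.inl rfl, inr (w + c), {w + c}, ?_, ?_⟩
      · rw [hwc, ← hσ, zero_add, add_assoc _ a, ← hb]; exact hΓ.right _
      · rw [add_zero]; exact hΓ.rem hc w
    · refine ⟨s, Or.inr rfl, inr w, {w + s}, ?_, (hΓ.rem hc w).symm⟩
      rw [show w = g + a + b by rw [hb, hw, sub_smul, one_smul, ← hσ]; abel]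
      exact hΓ.right _
  obtain ⟨s', hs', y, F, hy, hr⟩ := hlast
  have hmid : Γ.Adj (inr (g + s)) (inr (g + a + q • c)) := by
    rw [← hσ, show g + a + (s + τ • c) = g + s + b by rw [hb]; abel]; exact hΓ.right _
  have harc : Disjoint (RoseWindow.arc c (g + a) 0 (2 * (q - 1)))
      (RoseWindow.arc c (g + a) (2 * q - 1) (2 * addOrderOf c - 1)) := by
    rw [Set.disjoint_left]
    rintro _ ⟨n, hn1, hn2, rfl⟩ hn3
    rw [zig_mem_arc_iff (w := 0)] at hn3 <;> omega
  have harc' : ∀ z, z ∈ cell c (g + a) ↔ z ∈ RoseWindow.arc c (g + a) 0 (2 * (q - 1)) ∨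
      z ∈ RoseWindow.arc c (g + a) (2 * q - 1) (2 * addOrderOf c - 1) := by
    intro z
    constructor
    · rw [mem_cell_iff 0]
      rintro ⟨n, hn1, hn2, rfl⟩
      rw [zig_mem_arc_iff (w := 0), zig_mem_arc_iff (w := 0)] <;> omega
    · rintro (hz | hz) <;> exact arc_subset_cell hz
  have hwmem : inl w ∈ cell c (g + a + a) := by rw [← hwcell]; exact self_mem_cell c w
  refine ⟨w, s', hs', ?_, ?_⟩
  · rw [hw, add_right_comm _ _ a, QuotientAddGroup.mk_add, mk_zsmul_c, add_zero]
  rw [Set.disjoint_left] at h1 h2 h12 harc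
  refine ((Spans.single (inl w)).append (a1.append (h.append (a2.append hr hy ?_) hmid ?_)
    (hΓ.left g).symm ?_) (hΓ.left _).symm ?_).of ?_ (Set.empty_subset _)
  all_goals (try rw [Set.disjoint_left])
  all_goals grind

end IsRose

/-- The vertices with index `t + i • c` or `t + a + i • c` for some `i < γ`. -/
def block (a c : G) (γ : ℕ) (t : G) : Set (G ⊕ G) :=
  {x | ∃ i < γ, x.elim id id = t + i • c ∨ x.elim id id = t + a + i • c}

theorem mem_arc_iff {c t : G} {γ : ℕ} {x : G ⊕ G} :
    x ∈ arc c t (-1) (2 * γ - 2) ↔ ∃ i < γ, x.elim id id = t + i • c := by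
  constructor
  · rintro ⟨n, h1, h2, rfl⟩
    rcases Int.even_or_odd' n with ⟨i, rfl | rfl⟩
    · exact ⟨i.toNat, by omega, by
        rw [zig_even, ← natCast_zsmul, Int.toNat_of_nonneg (by omega)]; rfl⟩
    · refine ⟨(i + 1).toNat, by omega, ?_⟩
      rw [show 2 * i + 1 = 2 * (i + 1) - 1 by ring, zig_odd, ← natCast_zsmul,
        Int.toNat_of_nonneg (by omega)]; rfl
  · rintro ⟨i, hi, h⟩
    rcases x with x | x
    · refine ⟨2 * i, by omega, by omega, ?_⟩
      rw [zig_even, natCast_zsmul, ← h]; rfl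
    · refine ⟨2 * i - 1, by omega, by omega, ?_⟩
      rw [zig_odd, natCast_zsmul, ← h]; rfl

theorem mem_block_iff {a c t : G} {γ : ℕ} {x : G ⊕ G} :
    x ∈ block a c γ t ↔ x ∈ arc c t (-1) (2 * γ - 2) ∨ x ∈ arc c (t + a) (-1) (2 * γ - 2) := by
  rw [mem_arc_iff, mem_arc_iff, ← exists_or]
  simp only [← and_or_left]
  rfl

theorem disjoint_arc {a c : G} (ha : (π a : G ⧸ AddSubgroup.zmultiples c) ≠ 0) (t : G)
    (i j i' j' : ℤ) :
    Disjoint (arc c t i j) (arc c (t + a) i' j') := by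
  refine (disjoint_cells ?_).mono arc_subset_cell arc_subset_cell
  rw [Set.disjoint_singleton, QuotientAddGroup.mk_add, ne_eq, left_eq_add]
  exact ha

namespace IsRose

variable [Finite G] {Γ : SimpleGraph (G ⊕ G)} {a b c : G}

theorem span_block (hΓ : IsRose Γ a b c) (ha : (π a : G ⧸ AddSubgroup.zmultiples c) ≠ 0) {γ : ℕ}
    (hγ : 1 ≤ γ) (hγk : γ ≤ addOrderOf c) (t : G) :
    Spans Γ c (inr t) (inr (t + a)) (block a c γ t) ∅ := by
  have h1 := hΓ.arc t (i := -1) (j := 2 * (γ - 1 : ℤ)) (by omega) (by omega)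
  have h2 := (hΓ.arc (t + a) (i := -1) (j := 2 * (γ - 1 : ℤ)) (by omega) (by omega)).symm
  rw [zig_even, show (-1 : ℤ) = 2 * 0 - 1 by ring, zig_odd, zero_smul, add_zero] at h1 h2
  rw [add_right_comm] at h2
  refine (h1.append h2 (hΓ.left _) (disjoint_arc ha ..)).of (fun x => ?_) (Set.empty_subset _)
  rw [mem_block_iff, show (2 * γ - 2 : ℤ) = 2 * (γ - 1) by ring]
  rfl

theorem span_block_sdiff (hΓ : IsRose Γ a b c) (ha : (π a : G ⧸ AddSubgroup.zmultiples c) ≠ 0)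
    {γ : ℕ} (hγ : 1 ≤ γ) (hγk : γ ≤ addOrderOf c) (t : G) :
    Spans Γ c (inr t) (inl (t + a)) (block a c γ t \ {inr (t + a)}) ∅ := by
  have h1 := hΓ.arc t (i := -1) (j := 2 * (γ - 1 : ℤ)) (by omega) (by omega)
  have h2 := (hΓ.arc (t + a) (i := 0) (j := 2 * (γ - 1 : ℤ)) (by omega) (by omega)).symm
  rw [zig_even, show (-1 : ℤ) = 2 * 0 - 1 by ring, zig_odd, zero_smul, add_zero] at h1
  rw [zig_even, zig_zero, add_right_comm] at h2
  refine (h1.append h2 (hΓ.left _) (disjoint_arc ha ..)).of (fun x => ?_) (Set.empty_subset _)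
  have e0 : (inr (t + a) : G ⊕ G) = zig c (t + a) (-1) := by
    rw [show (-1 : ℤ) = 2 * 0 - 1 by ring, zig_odd, zero_smul, add_zero]
  have e1 : (inr (t + a) : G ⊕ G) ∉ RoseWindow.arc c t (-1) (2 * (γ - 1)) := by
    refine fun h => Set.disjoint_left.1 (disjoint_arc ha t (-1) (2 * (γ - 1)) (-1) (-1)) h ?_
    exact ⟨-1, le_rfl, le_rfl, e0.symm⟩
  have e2 : x ∈ RoseWindow.arc c (t + a) 0 (2 * (γ - 1)) ↔
      x ∈ RoseWindow.arc c (t + a) (-1) (2 * (γ - 1)) ∧ x ≠ inr (t + a) := by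
    rw [e0]
    constructor
    · rintro ⟨n, hn1, hn2, rfl⟩
      refine ⟨⟨n, by omega, hn2, rfl⟩, ?_⟩
      rw [Ne, zig_eq_iff (w := -1)] <;> omega
    · rintro ⟨⟨n, hn1, hn2, rfl⟩, hn3⟩
      rw [Ne, zig_eq_iff (w := -1)] at hn3 <;> try omega
      exact ⟨n, by omega, hn2, rfl⟩
  rw [Set.mem_union, e2, Set.mem_sdiff, mem_block_iff,
    show (2 * γ - 2 : ℤ) = 2 * (γ - 1) by ring, Set.mem_singleton_iff]
  have e3 : x ∈ RoseWindow.arc c t (-1) (2 * (γ - 1)) → x ≠ inr (t + a) := by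
    rintro h rfl; exact e1 h
  change _ ∨ _ ↔ _
  tauto

theorem span_pair (hΓ : IsRose Γ a b c) (ha : (π a : G ⧸ AddSubgroup.zmultiples c) ≠ 0)
    (hb : (π b : G ⧸ AddSubgroup.zmultiples c) = π a) :
    Spans Γ c (inl a) (inr a) (cell c 0 ∪ cell c a) ∅ := by
  obtain ⟨τ, hτ⟩ := mk_eq_mk_iff.1 hb.symm
  set e := τ • c with he
  set γ := addOrderOf (π c : G ⧸ AddSubgroup.zmultiples e) with hγdef
  set r := addOrderOf e with hr
  have hγ : 1 ≤ γ := addOrderOf_pos _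
  have hr1 : 1 ≤ r := addOrderOf_pos _
  have hγk : γ ≤ addOrderOf c := by
    refine addOrderOf_le_of_nsmul_eq_zero (addOrderOf_pos c) ?_
    rw [← QuotientAddGroup.mk_nsmul, addOrderOf_nsmul_eq_zero]; rfl
  have hme : ∀ n : ℤ, (π (n • e) : G ⧸ AddSubgroup.zmultiples c) = 0 := by
    intro n; rw [he, smul_smul, mk_zsmul_c]
  have huniq : ∀ {j j' i i' : ℕ}, 1 ≤ j → j ≤ r → 1 ≤ j' → j' ≤ r → i < γ → i' < γ →
      -(j : ℤ) • e + i • c = -(j' : ℤ) • e + i' • c → j = j' := by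
    intro j j' i i' h1 h2 h3 h4 h5 h6 h
    have hi := congrArg (QuotientAddGroup.mk : _ → G ⧸ AddSubgroup.zmultiples e) h
    rw [QuotientAddGroup.mk_add, QuotientAddGroup.mk_add, mk_zsmul_c, mk_zsmul_c, zero_add,
      zero_add, QuotientAddGroup.mk_nsmul, QuotientAddGroup.mk_nsmul] at hi
    obtain rfl := nsmul_inj_of_lt le_rfl h5 h6 hi
    have h7 := add_right_cancel h
    rw [← sub_eq_zero, ← sub_smul, ← addOrderOf_dvd_iff_zsmul_eq_zero] at h7
    have h8 := Int.eq_zero_of_abs_lt_dvd h7 (by rw [abs_lt]; constructor <;> omega)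
    omega
  have hdisj : ∀ {j j' : ℕ}, 1 ≤ j → j < j' → j' ≤ r →
      Disjoint (block a c γ (-(j : ℤ) • e)) (block a c γ (-(j' : ℤ) • e)) := by
    intro j j' h1 h2 h3
    rw [Set.disjoint_left]
    have hne : ∀ {i i' : ℕ} {n n' : ℤ}, n • e + i • c ≠ n' • e + a + i' • c := by
      intro i i' n n' h
      have := congrArg (QuotientAddGroup.mk : _ → G ⧸ AddSubgroup.zmultiples c) h
      rw [QuotientAddGroup.mk_add, QuotientAddGroup.mk_add, QuotientAddGroup.mk_add, hme, hme,
        QuotientAddGroup.mk_nsmul, QuotientAddGroup.mk_nsmul, mk_c] at this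
      simp only [smul_zero, zero_add, add_zero] at this
      exact ha this.symm
    rintro x ⟨i, hi, h | h⟩ ⟨i', hi', h' | h'⟩
    · rw [h] at h'
      have := huniq h1 (by omega) (by omega) h3 hi hi' h'
      omega
    · exact hne (h.symm.trans h')
    · exact hne (h'.symm.trans h)
    · rw [h, add_right_comm, add_right_comm _ a, add_left_inj] at h'
      have := huniq h1 (by omega) (by omega) h3 hi hi' h'
      omega
  have hmem_a : (inr a : G ⊕ G) ∈ block a c γ (-(r : ℤ) • e) := by
    refine ⟨0, hγ, Or.inr ?_⟩
    simp [hr, addOrderOf_nsmul_eq_zero]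
  have hadj : ∀ n : ℕ, Γ.Adj (inr (a + -(n : ℤ) • e)) (inr (-((n + 1 : ℕ) : ℤ) • e)) := by
    intro n
    have h := (hΓ.right (-((n + 1 : ℕ) : ℤ) • e)).symm
    have h2 : -((n + 1 : ℕ) : ℤ) • e + b = a + -(n : ℤ) • e := by
      rw [hτ]; push_cast; rw [neg_add, add_smul, neg_one_smul]; abel
    rwa [h2] at h
  have chain : ∀ n : ℕ, n + 1 ≤ r → Spans Γ c (inr a) (inr (a + -(n : ℤ) • e))
      {x | x = inr a ∨ ∃ j : ℕ, 1 ≤ j ∧ j ≤ n ∧ x ∈ block a c γ (-(j : ℤ) • e)} ∅ := by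
    intro n
    induction n with
    | zero =>
      intro _
      simp only [Nat.cast_zero, neg_zero, zero_smul, add_zero]
      refine (Spans.single (inr a)).of (fun x => ⟨Or.inl, ?_⟩) subset_rfl
      rintro (h | ⟨j, hj1, hj2, -⟩)
      · exact h
      · omega
    | succ n ih =>
      intro hn
      have hblk := hΓ.span_block ha hγ hγk (-((n + 1 : ℕ) : ℤ) • e)
      rw [add_comm _ a] at hblk
      refine ((ih (by omega)).append hblk (hadj n) ?_).of ?_ (Set.empty_subset _)
      · rw [Set.disjoint_left]
        rintro x (rfl | ⟨j, hj1, hj2, hx⟩) hx'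
        · exact Set.disjoint_left.1 (hdisj (by omega) (by omega) le_rfl) hx' hmem_a
        · exact Set.disjoint_left.1 (hdisj hj1 (by omega) (by omega)) hx hx'
      · intro x
        constructor
        · rintro ((rfl | ⟨j, hj1, hj2, hx⟩) | hx)
          · exact Or.inl rfl
          · exact Or.inr ⟨j, hj1, by omega, hx⟩
          · exact Or.inr ⟨n + 1, by omega, le_rfl, hx⟩
        · rintro (rfl | ⟨j, hj1, hj2, hx⟩)
          · exact Or.inl (Or.inl rfl)
          · rcases Nat.lt_or_ge n j with h | h
            · obtain rfl : j = n + 1 := by omega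
              exact Or.inr hx
            · exact Or.inl (Or.inr ⟨j, hj1, h, hx⟩)
  have hlast := hΓ.span_block_sdiff ha hγ hγk (-(r : ℤ) • e)
  have hre : -(r : ℤ) • e = 0 := by simp [hr, addOrderOf_nsmul_eq_zero]
  have hadj' := hadj (r - 1)
  rw [Nat.sub_add_cancel hr1] at hadj'
  rw [show -(r : ℤ) • e + a = a by rw [hre, zero_add]] at hlast
  have hcover : ∀ y : G, (π y : G ⧸ AddSubgroup.zmultiples c) = 0 →
      ∃ j : ℕ, 1 ≤ j ∧ j ≤ r ∧ ∃ i < γ, y = -(j : ℤ) • e + i • c := by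
    intro y hy
    rw [QuotientAddGroup.eq_zero_iff, AddSubgroup.mem_zmultiples_iff] at hy
    obtain ⟨n, rfl⟩ := hy
    have h1 : (π (n • c) : G ⧸ AddSubgroup.zmultiples e) ∈
        AddSubgroup.zmultiples (π c : G ⧸ AddSubgroup.zmultiples e) := ⟨n, rfl⟩
    obtain ⟨i, hi, h1⟩ := mem_zmultiples_iff_exists_lt.1 h1
    rw [← QuotientAddGroup.mk_nsmul, QuotientAddGroup.eq] at h1
    obtain ⟨j, hj, h1⟩ := mem_zmultiples_iff_exists_lt.1 h1
    rcases Nat.eq_zero_or_pos j with rfl | hj0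
    · refine ⟨r, hr1, le_rfl, i, hi, ?_⟩
      rw [hre, zero_add]
      rw [zero_smul, neg_add_eq_zero] at h1
      exact h1
    · refine ⟨j, hj0, hj.le, i, hi, ?_⟩
      rw [neg_smul, natCast_zsmul, ← h1]; abel
  refine ((chain (r - 1) (by omega)).append hlast hadj' ?_).symm.of ?_ (Set.empty_subset _)
  · rw [Set.disjoint_left]
    rintro x (rfl | ⟨j, hj1, hj2, hx⟩) ⟨hx1, hx2⟩
    · exact hx2 rfl
    · exact Set.disjoint_left.1 (hdisj hj1 (by omega) le_rfl) hx hx1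
  · intro x
    have hiff : x ∈ cell c 0 ∪ cell c a ↔
        ∃ j : ℕ, 1 ≤ j ∧ j ≤ r ∧ x ∈ block a c γ (-(j : ℤ) • e) := by
      change (π (x.elim id id) = _ ∨ π (x.elim id id) = _) ↔ _
      constructor
      · rintro (h | h)
        · obtain ⟨j, hj1, hj2, i, hi, hx⟩ := hcover _ h
          exact ⟨j, hj1, hj2, i, hi, Or.inl hx⟩
        · obtain ⟨j, hj1, hj2, i, hi, hx⟩ := hcover (x.elim id id - a) (by
            rw [QuotientAddGroup.mk_sub, h, sub_self])
          refine ⟨j, hj1, hj2, i, hi, Or.inr ?_⟩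
          rw [sub_eq_iff_eq_add] at hx
          rw [hx]; abel
      · rintro ⟨j, -, -, i, -, hx | hx⟩
        · left
          rw [hx, QuotientAddGroup.mk_add, hme, QuotientAddGroup.mk_nsmul, mk_c]; simp
        · right
          rw [hx, QuotientAddGroup.mk_add, QuotientAddGroup.mk_add, hme, QuotientAddGroup.mk_nsmul,
            mk_c]; simp
    rw [hiff]
    constructor
    · rintro ((rfl | ⟨j, hj1, hj2, hx⟩) | ⟨hx, -⟩)
      · exact ⟨r, hr1, le_rfl, hmem_a⟩
      · exact ⟨j, hj1, by omega, hx⟩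
      · exact ⟨r, hr1, le_rfl, hx⟩
    · rintro ⟨j, hj1, hj2, hx⟩
      by_cases hxa : x = inr a
      · exact Or.inl (Or.inl hxa)
      · rcases Nat.lt_or_ge j r with h | h
        · exact Or.inl (Or.inr ⟨j, hj1, by omega, hx⟩)
        · obtain rfl : j = r := by omega
          exact Or.inr ⟨hx, hxa⟩

/-- The case `a ∉ ⟨c⟩` and `a - b ∈ ⟨c⟩`. -/
theorem closed_of_eq (hΓ : IsRose Γ a b c) (hc : c ≠ 0)
    (hgen : ∀ w : G ⧸ AddSubgroup.zmultiples c, ∃ x y : ℤ, w = x • π a + y • π b)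
    (ha : (π a : G ⧸ AddSubgroup.zmultiples c) ≠ 0)
    (hb : (π b : G ⧸ AddSubgroup.zmultiples c) = π a) :
    Closed Γ c Set.univ ∅ := by
  obtain ⟨τ, hτ⟩ := mk_eq_mk_iff.1 hb.symm
  set A : G ⧸ AddSubgroup.zmultiples c := π a with hA
  set d := addOrderOf A with hd
  have hQ : ∀ w, ∃ i < d, w = i • A := by
    intro w
    rw [← mem_zmultiples_iff_exists_lt]
    obtain ⟨x, y, rfl⟩ := hgen w
    rw [hb, ← add_smul]
    exact ⟨_, rfl⟩
  let Y : ℕ → Prop := fun N => ∃ g s : G, (s = 0 ∨ s = c) ∧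
    (π (g + a) : G ⧸ AddSubgroup.zmultiples c) = N • A ∧
    Spans Γ c (inl g) (inr (g + s)) (cells c {w | ∃ i < N, w = i • A}) ∅
  have hY1 : Y 1 := by
    refine ⟨0, 0, Or.inl rfl, by simp [hA],
      (hΓ.full hc 0 (Or.inl rfl)).of (fun x => ?_) (Set.empty_subset _)⟩
    suffices ∀ w : G ⧸ AddSubgroup.zmultiples c, w = π 0 ↔ w ∈ {w | ∃ i < 1, w = i • A}
      from this _
    simp
  have hY2 : Y 2 := by
    refine ⟨a, 0, Or.inl rfl, by rw [two_nsmul, QuotientAddGroup.mk_add], ?_⟩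
    rw [add_zero]
    refine (hΓ.span_pair ha hb).of (fun x => ?_) (Set.empty_subset _)
    suffices ∀ w : G ⧸ AddSubgroup.zmultiples c, w = π 0 ∨ w = A ↔
      w ∈ {w | ∃ i < 2, w = i • A} from this _
    intro w
    simp only [Set.mem_ofPred_eq, Nat.exists_lt_succ_right]
    simp
  have hstep : ∀ N, N + 2 ≤ d → Y N → Y (N + 2) := by
    rintro N hN ⟨g, s, hs, hg, h⟩
    have hg' : (π (g + a + a) : G ⧸ AddSubgroup.zmultiples c) = (N + 1) • A := by
      rw [QuotientAddGroup.mk_add, hg, succ_nsmul]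
    have hne : ∀ i j : ℕ, i < j → j < d → i • A ≠ j • A := fun i j hi hj h1 =>
      hi.ne (nsmul_inj_of_lt le_rfl (by omega) hj h1)
    have h1 : Disjoint (cells c {w | ∃ i < N, w = i • A}) (cell c (g + a)) := by
      refine disjoint_cells ?_
      rw [Set.disjoint_singleton_right, hg]
      rintro ⟨i, hi, h1⟩
      exact hne i N hi (by omega) h1.symm
    have h2 : Disjoint (cells c {w | ∃ i < N, w = i • A}) (cell c (g + a + a)) := by
      refine disjoint_cells ?_
      rw [Set.disjoint_singleton_right, hg']
      rintro ⟨i, hi, h1⟩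
      exact hne i (N + 1) (by omega) (by omega) h1.symm
    have h12 : Disjoint (cell c (g + a)) (cell c (g + a + a)) := by
      refine disjoint_cells ?_
      rw [Set.disjoint_singleton, hg, hg']
      exact hne N (N + 1) (by omega) (by omega)
    obtain ⟨w, s', hs', hw, h'⟩ := hΓ.extend_two hc hτ hs h h1 h2 h12
    refine ⟨w, s', hs', ?_, h'.of (fun x => ?_) subset_rfl⟩
    · rw [QuotientAddGroup.mk_add, hw, hg', ← succ_nsmul]
    · suffices ∀ w, (w ∈ {w | ∃ i < N, w = i • A} ∨ w = π (g + a)) ∨ w = π (g + a + a) ↔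
          w ∈ {w | ∃ i < N + 2, w = i • A} from this _
      intro w
      rw [hg, hg']
      simp only [Set.mem_ofPred_eq]
      rw [← Nat.exists_lt_succ_right, ← Nat.exists_lt_succ_right]
  have hall : ∀ N, 1 ≤ N → N ≤ d → Y N := by
    intro N
    induction N using Nat.strong_induction_on with
    | _ N ih =>
      intro h1 h2
      rcases Nat.lt_or_ge N 3 with h | h
      · interval_cases N
        · exact hY1
        · exact hY2
      · obtain ⟨M, rfl⟩ := Nat.exists_eq_add_of_le' h
        exact hstep (M + 1) (by omega) (ih (M + 1) (by omega) (by omega) (by omega))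
  obtain ⟨g, s, hs, -, h⟩ := hall d (addOrderOf_pos A) le_rfl
  refine ⟨_, _, h.of (fun x => iff_of_true (hQ _) (Set.mem_univ x)) subset_rfl, ?_⟩
  rcases hs with rfl | rfl
  · rw [add_zero]; exact (hΓ.spoke g).symm
  · exact (hΓ.spoke_add g).symm

end IsRose

namespace IsRose

variable [Finite G] {Γ : SimpleGraph (G ⊕ G)} {a b c : G}

theorem chord_step (hΓ : IsRose Γ a b c) {α : ℕ} (hα : 1 ≤ α) (hαk : 2 * α + 1 ≤ addOrderOf c)
    (ha : a = α • c) {p t : G} (ht : t = p + b) {S : Set (G ⊕ G)}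
    (h : Spans Γ c (inr (p + (α + 1) • c)) (inl p) S ∅)
    (hS : Disjoint S (RoseWindow.arc c p 1 (2 * α))) (hpt : Disjoint (cell c p) (cell c t))
    (hSt : Disjoint S (cell c t)) :
    ∃ S', Spans Γ c (inr (t + (α + 1) • c + (α + 1) • c)) (inl (t + (α + 1) • c)) S' ∅ ∧
      Disjoint S' (RoseWindow.arc c (t + (α + 1) • c) 1 (2 * α)) ∧
      ∀ x, x ∈ S' ∨ x ∈ RoseWindow.arc c (t + (α + 1) • c) 1 (2 * α) ↔
        (x ∈ S ∨ x ∈ RoseWindow.arc c p 1 (2 * α)) ∨ x ∈ cell c t := by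
  have e1 : RoseWindow.arc c (t + (α + 1) • c) 1 (2 * α) =
      RoseWindow.arc c t (2 * α + 3) (4 * α + 2) := by
    have e : t + (α + 1) • c = t + ((α + 1 : ℕ) : ℤ) • c := by rw [natCast_zsmul]
    ext x
    constructor
    · rintro ⟨n, h1, h2, rfl⟩
      exact ⟨n + 2 * (α + 1 : ℕ), by omega, by omega, by rw [zig_add_mul, e]⟩
    · rintro ⟨n, h1, h2, rfl⟩
      refine ⟨n - 2 * (α + 1 : ℕ), by omega, by omega, ?_⟩
      rw [e, ← zig_add_mul, sub_add_cancel]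
  rw [e1]
  have s1 := hΓ.arc t (i := 4 * α + 3) (j := 2 * addOrderOf c + 1) (by omega) (by omega)
  have s2 := hΓ.arc p (i := 1) (j := 2 * α) (by omega) (by omega)
  have s3 := (hΓ.arc t (i := 2) (j := 2 * α + 1) (by omega) (by omega)).symm
  have z1 : zig c t (4 * α + 3) = inr (t + (α + 1) • c + (α + 1) • c) := by
    rw [show (4 * α + 3 : ℤ) = 2 * ((α + 1 + (α + 1) : ℕ) : ℤ) - 1 by push_cast; ring, zig_odd,
      natCast_zsmul, add_smul (α + 1), add_assoc]
  have z2 : zig c t (2 * addOrderOf c + 1) = inr (t + c) := by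
    rw [add_comm]
    have := zig_add_period (c := c) (g := t) 1 1
    rw [mul_one, zig_one] at this
    exact this
  have z3 : zig c t (2 * α + 1) = inr (t + (α + 1) • c) := by
    rw [show (2 * α + 1 : ℤ) = 2 * ((α + 1 : ℕ) : ℤ) - 1 by push_cast; ring, zig_odd,
      natCast_zsmul]
  have z4 : zig c t (2 * α + 2) = inl (t + (α + 1) • c) := by
    rw [show (2 * α + 2 : ℤ) = 2 * ((α + 1 : ℕ) : ℤ) by push_cast; ring, zig_even, natCast_zsmul]
  have z5 : zig c p (2 * α) = inl (p + α • c) := by rw [zig_even, natCast_zsmul]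
  rw [z1, z2] at s1
  rw [zig_one, z5] at s2
  rw [zig_two, z3] at s3
  have d1 : ∀ x ∈ RoseWindow.arc c t (4 * α + 3) (2 * addOrderOf c + 1),
      x ∉ RoseWindow.arc c t 2 (2 * α + 1) ∧ x ∉ RoseWindow.arc c t (2 * α + 3) (4 * α + 2) ∧
        x ≠ inl (t + (α + 1) • c) ∧ x ∈ cell c t := by
    rintro _ ⟨n, hn1, hn2, rfl⟩
    rw [← z4, Ne, zig_eq_iff (w := 2), zig_mem_arc_iff (w := 2), zig_mem_arc_iff (w := 2)] <;>
      first | omega | exact ⟨by omega, by omega, by omega, zig_mem_cell _⟩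
  have d2 : ∀ x ∈ RoseWindow.arc c t 2 (2 * α + 1),
      x ∉ RoseWindow.arc c t (2 * α + 3) (4 * α + 2) ∧
        x ≠ inl (t + (α + 1) • c) ∧ x ∈ cell c t := by
    rintro _ ⟨n, hn1, hn2, rfl⟩
    rw [← z4, Ne, zig_eq_iff (w := 2), zig_mem_arc_iff (w := 2)] <;>
      first | omega | exact ⟨by omega, by omega, zig_mem_cell _⟩
  have d3 : inl (t + (α + 1) • c) ∉ RoseWindow.arc c t (2 * α + 3) (4 * α + 2) ∧
      inl (t + (α + 1) • c) ∈ cell c t := by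
    rw [← z4, zig_mem_arc_iff (w := 2)] <;>
      first | omega | exact ⟨by omega, zig_mem_cell _⟩
  have d4 : ∀ x ∈ RoseWindow.arc c t (2 * α + 3) (4 * α + 2), x ∈ cell c t :=
    fun x hx => arc_subset_cell hx
  have d5 : ∀ x ∈ RoseWindow.arc c p 1 (2 * α), x ∈ cell c p := fun x hx => arc_subset_cell hx
  have d6 : ∀ x ∈ cell c t, x ∈ RoseWindow.arc c t (4 * α + 3) (2 * addOrderOf c + 1) ∨
      x ∈ RoseWindow.arc c t 2 (2 * α + 1) ∨ x = inl (t + (α + 1) • c) ∨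
        x ∈ RoseWindow.arc c t (2 * α + 3) (4 * α + 2) := by
    intro x
    rw [mem_cell_iff 2]
    rintro ⟨n, hn1, hn2, rfl⟩
    rw [← z4, zig_eq_iff (w := 2), zig_mem_arc_iff (w := 2), zig_mem_arc_iff (w := 2),
      zig_mem_arc_iff (w := 2)] <;> omega
  have j1 : Γ.Adj (inr (t + c)) (inr (p + c)) := by
    rw [ht, add_right_comm]; exact (hΓ.right _).symm
  have j2 : Γ.Adj (inl (p + α • c)) (inl p) := by rw [← ha]; exact (hΓ.left p).symm
  have j3 : Γ.Adj (inr (p + (α + 1) • c)) (inr (t + (α + 1) • c)) := by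
    rw [ht, add_right_comm]; exact hΓ.right _
  have j4 : Γ.Adj (inl (t + c)) (inl (t + (α + 1) • c)) := by
    rw [succ_nsmul', ← add_assoc, ← ha]; exact hΓ.left _
  rw [Set.disjoint_left] at hS hpt hSt
  refine ⟨_, (s1.append (s2.append (h.symm.append (s3.append (Spans.single _) j4 ?_) j3 ?_) j2 ?_)
    j1 ?_).of (fun _ => Iff.rfl) (Set.empty_subset _), ?_, ?_⟩
  all_goals (try rw [Set.disjoint_left])
  all_goals grind

theorem closed_of_chord (hΓ : IsRose Γ a b c)
    (hgen : ∀ w : G ⧸ AddSubgroup.zmultiples c, ∃ x y : ℤ, w = x • π a + y • π b)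
    {α : ℕ} (hα : 1 ≤ α) (hαk : 2 * α + 1 ≤ addOrderOf c) (ha : a = α • c) :
    Closed Γ c Set.univ ∅ := by
  set B : G ⧸ AddSubgroup.zmultiples c := π b with hB
  set d := addOrderOf B with hd
  have hA : (π a : G ⧸ AddSubgroup.zmultiples c) = 0 := by
    rw [ha, ← natCast_zsmul, mk_zsmul_c]
  have hQ : ∀ w, ∃ i < d, w = i • B := by
    intro w
    rw [← mem_zmultiples_iff_exists_lt]
    obtain ⟨x, y, rfl⟩ := hgen w
    rw [hA, smul_zero, zero_add]
    exact ⟨_, rfl⟩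
  have hall : ∀ N, 1 ≤ N → N ≤ d → ∃ p S, (π p : G ⧸ AddSubgroup.zmultiples c) = (N - 1) • B ∧
      Spans Γ c (inr (p + (α + 1) • c)) (inl p) S ∅ ∧
      Disjoint S (RoseWindow.arc c p 1 (2 * α)) ∧
      ∀ x, x ∈ S ∨ x ∈ RoseWindow.arc c p 1 (2 * α) ↔ x ∈ cells c {w | ∃ i < N, w = i • B} := by
    intro N hN
    induction N, hN using Nat.le_induction with
    | base =>
      intro _
      have h1 := hΓ.arc 0 (i := 2 * α + 1) (j := 2 * addOrderOf c) (by omega) (by omega)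
      rw [show (2 * α + 1 : ℤ) = 2 * ((α + 1 : ℕ) : ℤ) - 1 by push_cast; ring, zig_odd,
        natCast_zsmul, zig_period] at h1
      refine ⟨0, _, by simp, h1.of (fun _ => Iff.rfl) (Set.empty_subset _), ?_, fun x => ?_⟩
      · rw [Set.disjoint_left]
        rintro _ ⟨n, hn1, hn2, rfl⟩
        rw [zig_mem_arc_iff (w := 1)] <;> omega
      · have : x ∈ cells c {w | ∃ i < 1, w = i • B} ↔ x ∈ cell c 0 := by
          suffices ∀ w : G ⧸ AddSubgroup.zmultiples c, w ∈ {w | ∃ i < 1, w = i • B} ↔ w = π 0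
            from this _
          simp
        rw [this]
        constructor
        · rintro (hx | hx) <;> exact arc_subset_cell hx
        · rw [mem_cell_iff 1]
          rintro ⟨n, hn1, hn2, rfl⟩
          rw [zig_mem_arc_iff (w := 1), zig_mem_arc_iff (w := 1)] <;> omega
    | succ N hN ih =>
      intro hNd
      obtain ⟨p, S, hp, h, hS, hx⟩ := ih (by omega)
      have ht : (π (p + b) : G ⧸ AddSubgroup.zmultiples c) = N • B := by
        rw [QuotientAddGroup.mk_add, hp, ← succ_nsmul, Nat.sub_add_cancel hN]
      have hdis : Disjoint (cells c {w | ∃ i < N, w = i • B}) (cell c (p + b)) := by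
        refine disjoint_cells ?_
        rw [Set.disjoint_singleton_right, ht]
        rintro ⟨i, hi, h1⟩
        have := nsmul_inj_of_lt le_rfl (by omega) (by omega) h1
        omega
      have hpt : Disjoint (cell c p) (cell c (p + b)) := by
        refine hdis.mono_left fun x (hxp : _ = _) => ?_
        exact ⟨N - 1, by omega, hxp.trans hp⟩
      obtain ⟨S', h1, h2, h3⟩ := hΓ.chord_step hα hαk ha rfl h hS hpt
        (hdis.mono_left fun x hxS => (hx x).1 (Or.inl hxS))
      refine ⟨_, S', ?_, h1, h2, fun x => ?_⟩
      · rw [QuotientAddGroup.mk_add, ht, ← natCast_zsmul c, mk_zsmul_c, add_zero,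
          Nat.add_sub_cancel]
      · rw [h3, hx]
        suffices ∀ w, w ∈ {w | ∃ i < N, w = i • B} ∨ w = π (p + b) ↔
          w ∈ {w | ∃ i < N + 1, w = i • B} from this _
        intro w
        rw [ht]
        simp only [Set.mem_ofPred_eq]
        rw [← Nat.exists_lt_succ_right]
  obtain ⟨p, S, -, h, hS, hx⟩ := hall d (addOrderOf_pos B) le_rfl
  have h1 := hΓ.arc p (i := 1) (j := 2 * α) (by omega) (by omega)
  rw [zig_one, zig_even, natCast_zsmul] at h1
  refine ⟨_, _, (h.append h1 (hΓ.spoke_add p) hS).of (fun x => iff_of_true ?_ (Set.mem_univ x))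
    (Set.empty_subset _), ?_⟩
  · exact (hx x).2 (hQ _)
  · rw [succ_nsmul, ← add_assoc]; exact hΓ.spoke_add _

/-- The case `a ∈ ⟨c⟩`. -/
theorem closed_of_mk_eq_zero (hΓ : IsRose Γ a b c)
    (hgen : ∀ w : G ⧸ AddSubgroup.zmultiples c, ∃ x y : ℤ, w = x • π a + y • π b)
    (ha : (π a : G ⧸ AddSubgroup.zmultiples c) = 0) (ha2 : a + a ≠ 0) :
    Closed Γ c Set.univ ∅ := by
  rw [QuotientAddGroup.eq_zero_iff, mem_zmultiples_iff_exists_lt] at ha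
  obtain ⟨α, hα, rfl⟩ := ha
  have h0 : α ≠ 0 := by rintro rfl; simp at ha2
  have h2 : 2 * α ≠ addOrderOf c := by
    intro h
    rw [← add_smul, ← two_mul, h, addOrderOf_nsmul_eq_zero] at ha2
    exact ha2 rfl
  rcases Nat.lt_or_ge (2 * α) (addOrderOf c) with h | h
  · exact hΓ.closed_of_chord hgen (Nat.pos_of_ne_zero h0) h rfl
  · refine hΓ.neg_left.closed_of_chord (α := addOrderOf c - α) ?_ (by omega) (by omega) ?_
    · intro w
      obtain ⟨x, y, hw⟩ := hgen w
      exact ⟨-x, y, by rw [hw, QuotientAddGroup.mk_neg, neg_smul_neg]⟩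
    · rw [sub_nsmul _ hα.le, addOrderOf_nsmul_eq_zero, zero_add]

theorem closed (hΓ : IsRose Γ a b c) (hc : c ≠ 0) (ha : a + a ≠ 0) (hb : b + b ≠ 0)
    (hgen : ∀ w : G ⧸ AddSubgroup.zmultiples c, ∃ x y : ℤ, w = x • π a + y • π b) :
    Closed Γ c Set.univ ∅ := by
  by_cases hA : (π a : G ⧸ AddSubgroup.zmultiples c) = 0
  · exact hΓ.closed_of_mk_eq_zero hgen hA ha
  by_cases hB : (π b : G ⧸ AddSubgroup.zmultiples c) = 0
  · refine Closed.of_flip (hΓ.flip.closed_of_mk_eq_zero (fun w => ?_) hB hb)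
    obtain ⟨x, y, hw⟩ := hgen w
    exact ⟨y, x, by rw [hw, add_comm]⟩
  by_cases hAB : (π b : G ⧸ AddSubgroup.zmultiples c) = π a
  · exact hΓ.closed_of_eq hc hgen hA hAB
  by_cases hAB' : (π b : G ⧸ AddSubgroup.zmultiples c) = -π a
  · refine hΓ.neg_right.closed_of_eq hc (fun w => ?_) hA ?_
    · obtain ⟨x, y, hw⟩ := hgen w
      exact ⟨x, -y, by rw [hw, QuotientAddGroup.mk_neg, neg_smul_neg]⟩
    · rw [QuotientAddGroup.mk_neg, hAB', neg_neg]
  exact hΓ.closed_of_ne hc hgen hA hB hAB hAB'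

end IsRose

theorem isRose_bicirculant {m : ℕ} {R S T : Set (ZMod m)} {a b c : ZMod m} (ha : a ∈ R)
    (hb : b ∈ T) (hc : c ∈ S) (h0 : 0 ∈ S) (ha0 : a ≠ 0) (hb0 : b ≠ 0) :
    IsRose (bicirculant m R S T) a b c where
  left g := by
    rw [bicirculant, fromRel_adj]
    exact ⟨by simpa using ha0, Or.inl ⟨a, ha, rfl⟩⟩
  right g := by
    rw [bicirculant, fromRel_adj]
    exact ⟨by simpa using hb0, Or.inl ⟨b, hb, rfl⟩⟩
  spoke g := by
    rw [bicirculant, fromRel_adj]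
    exact ⟨by simp, Or.inl ⟨0, h0, by simp⟩⟩
  spoke_add g := by
    rw [bicirculant, fromRel_adj]
    exact ⟨by simp, Or.inl ⟨c, hc, rfl⟩⟩

theorem exists_zsmul_eq_of_gcd {m : ℕ} [NeZero m] {a b c : ZMod m}
    (h : Nat.gcd m (Nat.gcd a.val (Nat.gcd b.val c.val)) = 1) (w : ZMod m) :
    ∃ x y z : ℤ, w = x • a + y • b + z • c := by
  have h1 := Nat.gcd_eq_gcd_ab m (Nat.gcd a.val (Nat.gcd b.val c.val))
  rw [h, Nat.gcd_eq_gcd_ab a.val, Nat.gcd_eq_gcd_ab b.val] at h1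
  have h2 := congrArg (Int.cast : ℤ → ZMod m) h1
  push_cast at h2
  simp only [CharP.cast_eq_zero, zero_mul, zero_add, ZMod.natCast_val, ZMod.cast_id', id] at h2
  generalize Nat.gcdB m _ = q at h2
  generalize Nat.gcdA a.val _ = q1 at h2
  generalize Nat.gcdB a.val _ = q2 at h2
  generalize Nat.gcdA b.val _ = q3 at h2
  generalize Nat.gcdB b.val _ = q4 at h2
  obtain ⟨n, rfl⟩ := ZMod.intCast_surjective w
  refine ⟨n * q * q1, n * q * q2 * q3, n * q * q2 * q4, ?_⟩
  simp only [zsmul_eq_mul]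
  push_cast
  linear_combination (n : ZMod m) * h2

end RoseWindow

/-- A bicirculant `B(m;R,S,T)` that contains a connected generalized rose window
spanning subgraph — i.e. admits `a ∈ R`, `b ∈ T`, `c ∈ S` with `c ≠ 0`, `2a ≠ 0`,
`2b ≠ 0` and `gcd(m,a,b,c) = 1` — is hamiltonian. -/
theorem bicirculant_isHamiltonian_of_roseWindow_subgraph (m : ℕ) [NeZero m] (hm : 3 ≤ m)
    (R S T : Set (ZMod m))
    (hR : R = -R) (hT : T = -T) (h0RT : (0 : ZMod m) ∉ R ∪ T) (h0S : (0 : ZMod m) ∈ S)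
    (h : ∃ a ∈ R, ∃ b ∈ T, ∃ c ∈ S, c ≠ 0 ∧ 2 * a ≠ 0 ∧ 2 * b ≠ 0 ∧
      Nat.gcd m (Nat.gcd a.val (Nat.gcd b.val c.val)) = 1) :
    (bicirculant m R S T).IsHamiltonian := by
  obtain ⟨a, ha, b, hb, c, hc, hc0, ha2, hb2, hgcd⟩ := h
  have hΓ := RoseWindow.isRose_bicirculant ha hb hc h0S (right_ne_zero_of_mul ha2)
    (right_ne_zero_of_mul hb2)
  rw [two_mul] at ha2 hb2
  refine (hΓ.closed hc0 ha2 hb2 fun w => ?_).isHamiltonian ?_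
  · obtain ⟨w, rfl⟩ := QuotientAddGroup.mk_surjective w
    obtain ⟨x, y, z, rfl⟩ := RoseWindow.exists_zsmul_eq_of_gcd hgcd w
    refine ⟨x, y, ?_⟩
    rw [QuotientAddGroup.mk_add, RoseWindow.mk_zsmul_c, add_zero, QuotientAddGroup.mk_add,
      QuotientAddGroup.mk_zsmul, QuotientAddGroup.mk_zsmul]
  · rw [Fintype.card_sum, ZMod.card]; omega
end
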